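/- arXiv:2312.01803 — 2 statements merged into one kernel-verified Lean document; each statement's English description precedes it below -/
import Mathlib

section
/- For every θ ≥ 2, every c_0 > 0 and every choice of constants in the Harnack assumptions there exists C > 0 such that: for every Markov kernel (Γ,K,π) satisfying the Harnack assumptions with parameter θ and those constants, and all x,y ∈ V with d(x,y) ≥ c_0·D, the expected hitting time satisfies H(x,y) ≥ C·D^θ. -/
open Finset
open scoped Classical

variable {V : Type*} [Fintype V] [DecidableEq V]

/-- `matpow K n` is the `n`-th matrix power of the kernel `K`. -/
noncomputable def matpow (K : V → V → ℝ) : ℕ → V → V → ℝ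
  | 0 => fun x y => if x = y then (1 : ℝ) else 0
  | n + 1 => fun x y => ∑ z, K x z * matpow K n z y

/-- `(Γ, K, π)` is a Markov kernel: `G` is a connected (simple) graph on the finite vertex
set `V`, `K` is a stochastic kernel, irreducible, reversible with respect to the probability
measure `pi`, positive on edges and vanishing off edges (apart from the diagonal). -/
def IsMarkovKernel (G : SimpleGraph V) (K : V → V → ℝ) (pi : V → ℝ) : Prop :=
  G.Connected ∧
  (∀ x y, 0 ≤ K x y) ∧ (∀ x, ∑ y, K x y = 1) ∧
  (∀ x, 0 < pi x) ∧ (∑ x, pi x = 1) ∧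
  (∀ x y, pi x * K x y = pi y * K y x) ∧
  (∀ x y, G.Adj x y → 0 < K x y) ∧
  (∀ x y, x ≠ y → ¬ G.Adj x y → K x y = 0) ∧
  (∀ x y, ∃ n, 0 < matpow K n x y)

/-- Aperiodicity of an irreducible finite kernel, via primitivity. -/
def Aperiodic (K : V → V → ℝ) : Prop :=
  ∃ N : ℕ, ∀ n ≥ N, ∀ x y, 0 < matpow K n x y

/-- `K` is lazy if `K(x,x) ≥ 1/2` for all `x`. -/
def Lazy (K : V → V → ℝ) : Prop := ∀ x, (1 : ℝ) / 2 ≤ K x x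

/-- The closed ball `B(x,r)` for the graph distance. -/
noncomputable def gball (G : SimpleGraph V) (x : V) (r : ℝ) : Finset V :=
  univ.filter fun y => (G.dist x y : ℝ) ≤ r

/-- The volume `V(x,r) = π(B(x,r))`. -/
noncomputable def vol (G : SimpleGraph V) (pi : V → ℝ) (x : V) (r : ℝ) : ℝ :=
  ∑ y ∈ gball G x r, pi y

/-- The diameter of the graph `G`. -/
noncomputable def gdiam (G : SimpleGraph V) : ℕ :=
  univ.sup fun x => univ.sup fun y => G.dist x y

/-- The normalized kernel `k^n(x,y) = K^n(x,y)/π(y)`. -/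
noncomputable def knorm (K : V → V → ℝ) (pi : V → ℝ) (n : ℕ) (x y : V) : ℝ :=
  matpow K n x y / pi y

/-- The normalized Green function `𝒢(x,y) = ∑_{n≥0} (k^n(x,y) - 1)`. -/
noncomputable def green (K : V → V → ℝ) (pi : V → ℝ) (x y : V) : ℝ :=
  ∑' n : ℕ, (knorm K pi n x y - 1)

/-- `avoid K y n x = P_x(X_0 ≠ y, …, X_n ≠ y) = P_x(τ_y > n)`. -/
noncomputable def avoid (K : V → V → ℝ) (y : V) : ℕ → V → ℝ
  | 0 => fun x => if x = y then 0 else 1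
  | n + 1 => fun x => if x = y then 0 else ∑ z, K x z * avoid K y n z

/-- The expected hitting time `H(x,y) = E_x[τ_y] = ∑_{n≥0} P_x(τ_y > n)`. -/
noncomputable def hit (K : V → V → ℝ) (x y : V) : ℝ := ∑' n : ℕ, avoid K y n x

/-- `P_x(d(x, X_s) > R)` for the chain driven by `K` started at `x`. -/
noncomputable def probGt (G : SimpleGraph V) (K : V → V → ℝ) (x : V) (s : ℕ) (R : ℝ) : ℝ :=
  ∑ y ∈ univ.filter (fun y => R < (G.dist x y : ℝ)), matpow K s x y

/-- The probability that the chain driven by `K`, started at `x`, produces a trajectory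
`(X_0, …, X_t)` belonging to the event `A`. -/
noncomputable def pathProb (K : V → V → ℝ) (x : V) (t : ℕ)
    (A : (Fin (t + 1) → V) → Prop) : ℝ :=
  ∑ p ∈ univ.filter (fun p : Fin (t + 1) → V => p 0 = x ∧ A p),
    ∏ i : Fin t, K (p i.castSucc) (p i.succ)

/-- Condition (E): ellipticity with constant `p0`. -/
def CondE (G : SimpleGraph V) (K : V → V → ℝ) (p0 : ℝ) : Prop :=
  ∀ x y, G.Adj x y → p0 ≤ K x y

/-- Condition (VD): volume doubling with constant `CD`. -/
def CondVD (G : SimpleGraph V) (pi : V → ℝ) (CD : ℝ) : Prop :=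
  ∀ x : V, ∀ r : ℝ, 0 < r → vol G pi x (2 * r) ≤ CD * vol G pi x r

/-- The `π`-average of `f` over the ball `B(x,r)`. -/
noncomputable def ballAvg (G : SimpleGraph V) (pi : V → ℝ) (x : V) (r : ℝ) (f : V → ℝ) : ℝ :=
  (vol G pi x r)⁻¹ * ∑ z ∈ gball G x r, f z * pi z

/-- Condition (PI(θ)): Poincaré inequality with constant `CP`. -/
def CondPI (G : SimpleGraph V) (K : V → V → ℝ) (pi : V → ℝ) (θ CP : ℝ) : Prop :=
  ∀ x : V, ∀ r : ℝ, 0 < r → ∀ f : V → ℝ,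
    (∑ z ∈ gball G x r, |f z - ballAvg G pi x r f| ^ 2 * pi z) ≤
      CP * r ^ θ * ∑ ξ ∈ gball G x r, ∑ ζ ∈ gball G x r,
        if G.Adj ξ ζ then |f ξ - f ζ| ^ 2 * K ξ ζ * pi ξ else 0

/-- Condition (CS(θ)): existence of cut-off functions. -/
def CondCS (G : SimpleGraph V) (K : V → V → ℝ) (pi : V → ℝ) (θ C1 C2 ε : ℝ) : Prop :=
  ∀ x : V, ∀ r : ℝ, 0 < r → ∃ σ : V → ℝ,
    (∀ y ∈ gball G x (r / 2), 1 ≤ σ y) ∧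
    (∀ y, y ∉ gball G x r → σ y = 0) ∧
    (∀ z y, |σ z - σ y| ≤ C1 * ((G.dist z y : ℝ) / r) ^ ε) ∧
    (∀ s : ℝ, 0 < s → s ≤ r → ∀ f : V → ℝ,
      (∑ z ∈ gball G x s, |f z| ^ 2 *
          ∑ y, (if G.Adj z y then |σ z - σ y| ^ 2 * K z y * pi z else 0)) ≤
        C2 * (s / r) ^ (2 * ε) *
          ((∑ z ∈ gball G x (2 * s), ∑ y ∈ gball G x (2 * s),
              if G.Adj z y then |f z - f y| ^ 2 * K z y * pi z else 0) +
            s ^ (-θ) * ∑ z ∈ gball G x (2 * s), |f z| ^ 2 * pi z))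

/-- The Harnack assumptions (E), (VD), (PI(θ)), (CS(θ)) with the given constants. -/
def Harnack (G : SimpleGraph V) (K : V → V → ℝ) (pi : V → ℝ)
    (θ p0 CD CP Ccs1 Ccs2 ε : ℝ) : Prop :=
  0 < p0 ∧ 0 < CD ∧ 0 < CP ∧ 0 < Ccs1 ∧ 0 < Ccs2 ∧ 0 < ε ∧
  CondE G K p0 ∧ CondVD G pi CD ∧ CondPI G K pi θ CP ∧ CondCS G K pi θ Ccs1 Ccs2 ε


/-- The abstract setting extracted from a Harnack Markov kernel. -/
structure Sys (V : Type) [Fintype V] (θ CD CP C2 : ℝ) where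
  d : V → V → ℝ
  c : V → V → ℝ
  pi : V → ℝ
  d_self : ∀ x, d x x = 0
  d_comm : ∀ x y, d x y = d y x
  d_tri : ∀ x y z, d x z ≤ d x y + d y z
  d_nonneg : ∀ x y, 0 ≤ d x y
  c_nonneg : ∀ x y, 0 ≤ c x y
  c_comm : ∀ x y, c x y = c y x
  c_sum : ∀ x, ∑ y, c x y = pi x
  pi_pos : ∀ x, 0 < pi x
  pi_sum : ∑ x, pi x = 1
  c_dist : ∀ x y, 1 < d x y → c x y = 0
  hθ : 2 ≤ θ
  hCD : 1 ≤ CD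
  hCP : 0 < CP
  hC2 : 0 < C2
  vd : ∀ x r, 0 < r → ∑ w ∈ univ.filter (fun w => d x w ≤ 2 * r), pi w
        ≤ CD * ∑ w ∈ univ.filter (fun w => d x w ≤ r), pi w
  poin : ∀ x r, 0 < r → ∀ f : V → ℝ,
    ∑ z ∈ univ.filter (fun w => d x w ≤ r),
      (f z - (∑ w ∈ univ.filter (fun w => d x w ≤ r), pi w)⁻¹ *
        ∑ w ∈ univ.filter (fun w => d x w ≤ r), f w * pi w) ^ 2 * pi z ≤
      CP * r ^ θ * ∑ ξ ∈ univ.filter (fun w => d x w ≤ r),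
        ∑ ζ ∈ univ.filter (fun w => d x w ≤ r), (f ξ - f ζ) ^ 2 * c ξ ζ
  cs : ∀ x s, 0 < s → ∃ σ : V → ℝ, (∀ y, 0 ≤ σ y) ∧ (∀ y, σ y ≤ 1) ∧
    (∀ y, d x y ≤ s / 2 → σ y = 1) ∧ (∀ y, s < d x y → σ y = 0) ∧
    ∀ f : V → ℝ, ∑ z ∈ univ.filter (fun w => d x w ≤ s), f z ^ 2 * ∑ y, (σ z - σ y) ^ 2 * c z y ≤
      C2 * ((∑ z ∈ univ.filter (fun w => d x w ≤ 2 * s),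
          ∑ y ∈ univ.filter (fun w => d x w ≤ 2 * s), (f z - f y) ^ 2 * c z y) +
        s ^ (-θ) * ∑ z ∈ univ.filter (fun w => d x w ≤ 2 * s), f z ^ 2 * pi z)

namespace Sys

section
variable {V : Type} [Fintype V] {θ CD CP C2 : ℝ} (S : Sys V θ CD CP C2)

/-- Ball. -/
noncomputable def B (x : V) (r : ℝ) : Finset V := univ.filter (fun w => S.d x w ≤ r)

/-- Volume. -/
noncomputable def vl (x : V) (r : ℝ) : ℝ := ∑ w ∈ S.B x r, S.pi w

/-- Energy restricted to pairs in a set. -/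
noncomputable def En (U : Finset V) (f : V → ℝ) : ℝ := ∑ v ∈ U, ∑ w ∈ U, (f v - f w) ^ 2 * S.c v w

lemma mem_B {x w : V} {r : ℝ} : w ∈ S.B x r ↔ S.d x w ≤ r := by simp [B]

lemma pi_nonneg (x : V) : 0 ≤ S.pi x := (S.pi_pos x).le

lemma vl_pos (x : V) {r : ℝ} (hr : 0 ≤ r) : 0 < S.vl x r := by
  apply Finset.sum_pos (fun w _ => S.pi_pos w)
  exact ⟨x, by rw [mem_B, S.d_self]; exact hr⟩

lemma vl_dbl (x : V) {r : ℝ} (hr : 0 < r) (n : ℕ) : S.vl x (2 ^ n * r) ≤ CD ^ n * S.vl x r := by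
  induction n with
  | zero => simp
  | succ n ih =>
    have h := S.vd x (2 ^ n * r) (by positivity)
    have h0 := S.hCD
    calc S.vl x (2 ^ (n+1) * r) = S.vl x (2 * (2 ^ n * r)) := by congr 1; ring
      _ ≤ CD * S.vl x (2 ^ n * r) := h
      _ ≤ CD * (CD ^ n * S.vl x r) := by gcongr
      _ = _ := by ring

lemma vl_mono {x y : V} {r s : ℝ} (h : ∀ w, S.d x w ≤ r → S.d y w ≤ s) : S.vl x r ≤ S.vl y s := by
  apply Finset.sum_le_sum_of_subset_of_nonneg
  · intro w hw; rw [mem_B] at *; exact h w hw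
  · intro i _ _; exact S.pi_nonneg i

lemma En_nonneg (U : Finset V) (f : V → ℝ) : 0 ≤ S.En U f :=
  Finset.sum_nonneg fun v _ => Finset.sum_nonneg fun w _ => mul_nonneg (sq_nonneg _) (S.c_nonneg _ _)

lemma exists_net (s : ℝ) (hs : 0 < s) : ∃ N : Finset V, (∀ v, ∃ z ∈ N, S.d z v ≤ s / 2) ∧
    ∀ v, ((N.filter (fun z => S.d z v ≤ 2 * s)).card : ℝ) ≤ CD ^ 5 := by
  classical
  let P : Finset V → Prop := fun N => ∀ z ∈ N, ∀ z' ∈ N, z ≠ z' → s / 2 < S.d z z'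
  obtain ⟨N, hN⟩ := (Set.toFinite {N : Finset V | P N}).exists_maximal ⟨∅, by simp [P]⟩
  have hP : P N := hN.prop
  refine ⟨N, ?_, ?_⟩
  · intro v
    by_contra! hcon
    have hv : v ∉ N := by
      intro h
      have := hcon v h
      rw [S.d_self] at this; linarith
    have hP' : P (insert v N) := by
      intro z hz z' hz' hne
      rw [Finset.mem_insert] at hz hz'
      rcases hz with rfl | hz <;> rcases hz' with rfl | hz'
      · exact absurd rfl hne
      · rw [S.d_comm]; exact hcon _ hz'
      · exact hcon _ hz
      · exact hP z hz z' hz' hne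
    have := hN.le_of_ge (y := insert v N) hP' (Finset.subset_insert v N)
    exact hv (this (Finset.mem_insert_self v N))
  · intro v
    set M := N.filter (fun z => S.d z v ≤ 2 * s) with hM
    have hpos : 0 < S.vl v (6 * s) := S.vl_pos v (by positivity)
    have h1 : ∀ z ∈ M, S.vl v (6 * s) ≤ CD ^ 5 * S.vl z (s / 4) := by
      intro z hz
      have hz2 := (Finset.mem_filter.1 hz).2
      refine le_trans ?_ (S.vl_dbl z (by positivity : 0 < s / 4) 5)
      apply S.vl_mono
      intro w hw
      have := S.d_tri z v w
      linarith
    have h2 : ∑ z ∈ M, S.vl z (s / 4) ≤ S.vl v (6 * s) := by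
      unfold vl
      rw [← Finset.sum_biUnion]
      · apply Finset.sum_le_sum_of_subset_of_nonneg
        · intro w hw
          obtain ⟨z, hz, hw⟩ := Finset.mem_biUnion.1 hw
          rw [mem_B] at *
          have hz2 := (Finset.mem_filter.1 hz).2
          have := S.d_tri v z w
          rw [S.d_comm v z] at this
          linarith
        · intro i _ _; exact S.pi_nonneg i
      · intro z hz z' hz' hne
        rw [Function.onFun, Finset.disjoint_left]
        intro w hw hw'
        rw [mem_B] at hw hw'
        have := hP z (Finset.mem_filter.1 hz).1 z' (Finset.mem_filter.1 hz').1 hne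
        have h3 := S.d_tri z w z'
        rw [S.d_comm w z'] at h3
        linarith
    have h3 : (M.card : ℝ) * S.vl v (6 * s) ≤ CD ^ 5 * S.vl v (6 * s) := by
      have hCD := S.hCD
      calc (M.card : ℝ) * S.vl v (6 * s) = ∑ z ∈ M, S.vl v (6 * s) := by simp
        _ ≤ ∑ z ∈ M, CD ^ 5 * S.vl z (s / 4) := Finset.sum_le_sum h1
        _ = CD ^ 5 * ∑ z ∈ M, S.vl z (s / 4) := by rw [Finset.mul_sum]
        _ ≤ _ := by gcongr
    exact le_of_mul_le_mul_right h3 hpos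

/-- Bounded overlap: sums of pair energies. -/
lemma overlap_En (N : Finset V) (L : ℝ) (r : ℝ)
    (hN : ∀ v, ((N.filter (fun z => S.d z v ≤ r)).card : ℝ) ≤ L)
    (U : Finset V) (hU : ∀ z ∈ N, S.B z r ⊆ U) (f : V → ℝ) :
    ∑ z ∈ N, S.En (S.B z r) f ≤ L * S.En U f := by
  have h1 : ∀ z ∈ N, S.En (S.B z r) f ≤
      ∑ v ∈ U, ∑ w ∈ U, (if S.d z v ≤ r then (f v - f w) ^ 2 * S.c v w else 0) := by
    intro z hz
    have hsub := hU z hz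
    unfold En
    calc _ ≤ ∑ v ∈ S.B z r, ∑ w ∈ U, (f v - f w) ^ 2 * S.c v w := by
          apply Finset.sum_le_sum; intro v _
          apply Finset.sum_le_sum_of_subset_of_nonneg hsub
          intro w _ _; exact mul_nonneg (sq_nonneg _) (S.c_nonneg _ _)
      _ = ∑ v ∈ S.B z r, ∑ w ∈ U, (if S.d z v ≤ r then (f v - f w) ^ 2 * S.c v w else 0) := by
          apply Finset.sum_congr rfl; intro v hv
          rw [mem_B] at hv
          simp [hv]
      _ ≤ _ := by
          apply Finset.sum_le_sum_of_subset_of_nonneg hsub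
          intro v _ _
          apply Finset.sum_nonneg; intro w _
          split_ifs
          · exact mul_nonneg (sq_nonneg _) (S.c_nonneg _ _)
          · exact le_rfl
  calc _ ≤ ∑ z ∈ N, ∑ v ∈ U, ∑ w ∈ U,
        (if S.d z v ≤ r then (f v - f w) ^ 2 * S.c v w else 0) := Finset.sum_le_sum h1
    _ = ∑ v ∈ U, ∑ w ∈ U, ∑ z ∈ N,
        (if S.d z v ≤ r then (f v - f w) ^ 2 * S.c v w else 0) := by
        rw [Finset.sum_comm]
        apply Finset.sum_congr rfl; intro v _
        rw [Finset.sum_comm]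
    _ ≤ ∑ v ∈ U, ∑ w ∈ U, L * ((f v - f w) ^ 2 * S.c v w) := by
        apply Finset.sum_le_sum; intro v _
        apply Finset.sum_le_sum; intro w _
        rw [← Finset.sum_filter, Finset.sum_const, nsmul_eq_mul]
        exact mul_le_mul_of_nonneg_right (hN v) (mul_nonneg (sq_nonneg _) (S.c_nonneg _ _))
    _ = _ := by simp only [En, Finset.mul_sum]

lemma overlap_sq (N : Finset V) (L : ℝ) (r : ℝ)
    (hN : ∀ v, ((N.filter (fun z => S.d z v ≤ r)).card : ℝ) ≤ L) (h : V → ℝ) (hh : ∀ v, 0 ≤ h v) :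
    ∑ z ∈ N, ∑ v ∈ S.B z r, h v ≤ L * ∑ v, h v := by
  unfold B
  simp only [Finset.sum_filter]
  rw [Finset.sum_comm, Finset.mul_sum]
  apply Finset.sum_le_sum; intro v _
  rw [← Finset.sum_filter, Finset.sum_const, nsmul_eq_mul]
  exact mul_le_mul_of_nonneg_right (hN v) (hh v)

/-- Local Faber-Krahn. -/
lemma fk_local (z : V) (s : ℝ) (hs : 0 < s) (f : V → ℝ)
    (hf : ∑ v ∈ univ.filter (fun v => f v ≠ 0), S.pi v ≤ S.vl z s / 2) :
    ∑ v ∈ S.B z s, f v ^ 2 * S.pi v ≤ 2 * CP * s ^ θ * S.En (S.B z s) f := by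
  have hp := S.poin z s hs f
  change ∑ v ∈ S.B z s, (f v - (S.vl z s)⁻¹ * ∑ w ∈ S.B z s, f w * S.pi w) ^ 2 * S.pi v ≤
    CP * s ^ θ * S.En (S.B z s) f at hp
  have hv : 0 < S.vl z s := S.vl_pos z hs.le
  set I := ∑ w ∈ S.B z s, f w * S.pi w with hI
  set Q := ∑ v ∈ S.B z s, f v ^ 2 * S.pi v with hQ
  have hexp : ∑ v ∈ S.B z s, (f v - (S.vl z s)⁻¹ * I) ^ 2 * S.pi v = Q - I ^ 2 / S.vl z s := by
    have : ∀ v ∈ S.B z s, (f v - (S.vl z s)⁻¹ * I) ^ 2 * S.pi v =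
        f v ^ 2 * S.pi v - 2 * ((S.vl z s)⁻¹ * I) * (f v * S.pi v)
          + ((S.vl z s)⁻¹ * I) ^ 2 * S.pi v := by intro v _; ring
    rw [Finset.sum_congr rfl this, Finset.sum_add_distrib, Finset.sum_sub_distrib,
      ← Finset.mul_sum, ← Finset.mul_sum]
    change Q - 2 * ((S.vl z s)⁻¹ * I) * I + ((S.vl z s)⁻¹ * I) ^ 2 * S.vl z s = _
    field_simp
    ring
  have hQ0 : 0 ≤ Q := Finset.sum_nonneg fun v _ => mul_nonneg (sq_nonneg _) (S.pi_nonneg v)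
  have hI2 : I ^ 2 ≤ Q * (S.vl z s / 2) := by
    have hcs := Finset.sum_mul_sq_le_sq_mul_sq (S.B z s) (fun v => f v * √(S.pi v))
      (fun v => if f v ≠ 0 then √(S.pi v) else 0)
    have e1 : ∀ v, f v * √(S.pi v) * (if f v ≠ 0 then √(S.pi v) else 0) = f v * S.pi v := by
      intro v
      by_cases h : f v = 0
      · simp [h]
      · simp only [ne_eq, h, not_false_eq_true, if_true, mul_assoc, Real.mul_self_sqrt (S.pi_nonneg v)]
    have e2 : ∀ v, (f v * √(S.pi v)) ^ 2 = f v ^ 2 * S.pi v := by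
      intro v; rw [mul_pow, Real.sq_sqrt (S.pi_nonneg v)]
    have e3 : ∀ v, (if f v ≠ 0 then √(S.pi v) else 0) ^ 2 = if f v ≠ 0 then S.pi v else 0 := by
      intro v; split_ifs
      · rw [Real.sq_sqrt (S.pi_nonneg v)]
      · simp
    simp only [e1, e2, e3] at hcs
    refine hcs.trans ?_
    refine mul_le_mul_of_nonneg_left (le_trans ?_ hf) hQ0
    rw [Finset.sum_filter]
    apply Finset.sum_le_sum_of_subset_of_nonneg (Finset.subset_univ _)
    intro v _ _; split_ifs
    · exact S.pi_nonneg v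
    · exact le_rfl
  have hI3 : I ^ 2 / S.vl z s ≤ Q / 2 := by
    rw [div_le_iff₀ hv]; linarith
  rw [hexp] at hp
  linarith

/-- Faber-Krahn type inequality. -/
lemma fk (s : ℝ) (hs : 0 < s) (f : V → ℝ)
    (hf : ∀ z, ∑ v ∈ univ.filter (fun v => f v ≠ 0), S.pi v ≤ S.vl z s / 2) :
    ∑ v, f v ^ 2 * S.pi v ≤ 2 * CP * CD ^ 5 * s ^ θ * S.En univ f := by
  obtain ⟨N, hN1, hN2⟩ := S.exists_net s hs
  have hov : ∀ v, ((N.filter (fun z => S.d z v ≤ s)).card : ℝ) ≤ CD ^ 5 := by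
    intro v
    refine le_trans ?_ (hN2 v)
    norm_cast
    apply Finset.card_le_card
    intro z hz
    rw [Finset.mem_filter] at *
    exact ⟨hz.1, by linarith [hz.2]⟩
  have h1 : ∑ v, f v ^ 2 * S.pi v ≤ ∑ z ∈ N, ∑ v ∈ S.B z s, f v ^ 2 * S.pi v := by
    unfold B
    simp only [Finset.sum_filter]
    rw [Finset.sum_comm]
    apply Finset.sum_le_sum; intro v _
    obtain ⟨z, hz, hzv⟩ := hN1 v
    have h0 : ∀ z ∈ N, 0 ≤ if S.d z v ≤ s then f v ^ 2 * S.pi v else 0 := by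
      intro z _; split_ifs
      · exact mul_nonneg (sq_nonneg _) (S.pi_nonneg v)
      · exact le_rfl
    refine le_trans ?_ (Finset.single_le_sum h0 hz)
    rw [if_pos (by linarith)]
  have hCP := S.hCP
  calc _ ≤ _ := h1
    _ ≤ ∑ z ∈ N, 2 * CP * s ^ θ * S.En (S.B z s) f :=
        Finset.sum_le_sum fun z _ => S.fk_local z s hs f (hf z)
    _ = 2 * CP * s ^ θ * ∑ z ∈ N, S.En (S.B z s) f := by rw [Finset.mul_sum]
    _ ≤ 2 * CP * s ^ θ * (CD ^ 5 * S.En univ f) := by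
        apply mul_le_mul_of_nonneg_left _ (by positivity)
        exact S.overlap_En N _ s hov univ (fun _ _ => Finset.subset_univ _) f
    _ = _ := by ring


/-- Complement of a ball. -/
noncomputable def Ext (x : V) (ρ : ℝ) : Finset V := univ.filter (fun v => ρ < S.d x v)

/-- Annulus. -/
noncomputable def Ann (x : V) (a b : ℝ) : Finset V := univ.filter (fun v => a < S.d x v ∧ S.d x v ≤ b)

lemma En_mono {U W : Finset V} (h : U ⊆ W) (f : V → ℝ) : S.En U f ≤ S.En W f := by
  unfold En
  have h0 : ∀ v w, 0 ≤ (f v - f w) ^ 2 * S.c v w := fun v w => mul_nonneg (sq_nonneg _) (S.c_nonneg _ _)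
  calc _ ≤ ∑ v ∈ U, ∑ w ∈ W, (f v - f w) ^ 2 * S.c v w :=
        Finset.sum_le_sum fun v _ => Finset.sum_le_sum_of_subset_of_nonneg h fun w _ _ => h0 v w
    _ ≤ _ := Finset.sum_le_sum_of_subset_of_nonneg h fun v _ _ => Finset.sum_nonneg fun w _ => h0 v w

lemma En_add {U U' W : Finset V} (h : U ⊆ W) (h' : U' ⊆ W) (hd : Disjoint U U') (f : V → ℝ) :
    S.En U f + S.En U' f ≤ S.En W f := by
  have h0 : ∀ v w, 0 ≤ (f v - f w) ^ 2 * S.c v w := fun v w => mul_nonneg (sq_nonneg _) (S.c_nonneg _ _)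
  calc S.En U f + S.En U' f ≤ ∑ v ∈ U, ∑ w ∈ W, (f v - f w) ^ 2 * S.c v w
        + ∑ v ∈ U', ∑ w ∈ W, (f v - f w) ^ 2 * S.c v w := by
        apply add_le_add
        · exact Finset.sum_le_sum fun v _ => Finset.sum_le_sum_of_subset_of_nonneg h fun w _ _ => h0 v w
        · exact Finset.sum_le_sum fun v _ => Finset.sum_le_sum_of_subset_of_nonneg h' fun w _ _ => h0 v w
    _ = ∑ v ∈ U ∪ U', ∑ w ∈ W, (f v - f w) ^ 2 * S.c v w := (Finset.sum_union hd).symm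
    _ ≤ _ := Finset.sum_le_sum_of_subset_of_nonneg (Finset.union_subset h h')
        fun v _ _ => Finset.sum_nonneg fun w _ => h0 v w

/-- Total energy is at most four times the L2 norm. -/
lemma En_le (U : Finset V) (f : V → ℝ) : S.En U f ≤ 4 * ∑ v, f v ^ 2 * S.pi v := by
  refine (S.En_mono (Finset.subset_univ U) f).trans ?_
  have h1 : ∑ v, ∑ w, f v ^ 2 * S.c v w = ∑ v, f v ^ 2 * S.pi v := by
    apply Finset.sum_congr rfl; intro v _
    rw [← Finset.mul_sum, S.c_sum]
  have h2 : ∑ v, ∑ w, f w ^ 2 * S.c v w = ∑ v, f v ^ 2 * S.pi v := by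
    rw [Finset.sum_comm, ← h1]
    apply Finset.sum_congr rfl; intro v _
    apply Finset.sum_congr rfl; intro w _
    rw [S.c_comm]
  calc S.En univ f ≤ ∑ v, ∑ w, (2 * (f v ^ 2 * S.c v w) + 2 * (f w ^ 2 * S.c v w)) := by
        unfold En
        apply Finset.sum_le_sum; intro v _
        apply Finset.sum_le_sum; intro w _
        nlinarith [mul_nonneg (sq_nonneg (f v + f w)) (S.c_nonneg v w)]
    _ = 2 * ∑ v, ∑ w, f v ^ 2 * S.c v w + 2 * ∑ v, ∑ w, f w ^ 2 * S.c v w := by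
        simp only [Finset.sum_add_distrib, Finset.mul_sum]
    _ = _ := by rw [h1, h2]; ring

/-- Single ball cutoff inequality, including edges leaving the ball. -/
lemma cs_full (z : V) (s : ℝ) (hs : 1 ≤ s) : ∃ σ : V → ℝ, (∀ y, 0 ≤ σ y) ∧ (∀ y, σ y ≤ 1) ∧
    (∀ y, S.d z y ≤ s / 2 → σ y = 1) ∧ (∀ y, s < S.d z y → σ y = 0) ∧
    ∀ f : V → ℝ, ∑ v, ∑ w, f v ^ 2 * (σ v - σ w) ^ 2 * S.c v w ≤
      (3 * C2 + 2) * (S.En (S.B z (2 * s)) f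
        + s ^ (-θ) * ∑ v ∈ S.B z (2 * s), f v ^ 2 * S.pi v) := by
  obtain ⟨σ, h0, h1, h2, h3, h4⟩ := S.cs z s (by linarith)
  refine ⟨σ, h0, h1, h2, h3, fun f => ?_⟩
  have h5 := h4 f
  change ∑ v ∈ S.B z s, f v ^ 2 * ∑ y, (σ v - σ y) ^ 2 * S.c v y ≤
    C2 * (S.En (S.B z (2 * s)) f + s ^ (-θ) * ∑ v ∈ S.B z (2 * s), f v ^ 2 * S.pi v) at h5
  set R := S.En (S.B z (2 * s)) f + s ^ (-θ) * ∑ v ∈ S.B z (2 * s), f v ^ 2 * S.pi v with hR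
  have hER : S.En (S.B z (2 * s)) f ≤ R := by
    rw [hR]
    have : 0 ≤ s ^ (-θ) * ∑ v ∈ S.B z (2 * s), f v ^ 2 * S.pi v :=
      mul_nonneg (Real.rpow_nonneg (by linarith) _)
        (Finset.sum_nonneg fun v _ => mul_nonneg (sq_nonneg _) (S.pi_nonneg v))
    linarith
  set A := ∑ v, ∑ w, (if S.d z v ≤ s then f v ^ 2 * (σ v - σ w) ^ 2 * S.c v w else 0) with hA
  have hA1 : A ≤ C2 * R := by
    refine le_trans (le_of_eq ?_) h5
    unfold B
    rw [hA, Finset.sum_filter]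
    apply Finset.sum_congr rfl; intro v _
    split_ifs
    · rw [Finset.mul_sum]; apply Finset.sum_congr rfl; intro w _; ring
    · simp
  have hA2 : A = ∑ v, ∑ w, (if S.d z w ≤ s then f w ^ 2 * (σ v - σ w) ^ 2 * S.c v w else 0) := by
    rw [hA, Finset.sum_comm]
    apply Finset.sum_congr rfl; intro v _
    apply Finset.sum_congr rfl; intro w _
    split_ifs
    · rw [S.c_comm]; ring
    · rfl
  have hE : S.En (S.B z (2 * s)) f = ∑ v, ∑ w, (if S.d z v ≤ 2 * s ∧ S.d z w ≤ 2 * s then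
      (f v - f w) ^ 2 * S.c v w else 0) := by
    unfold En B
    rw [Finset.sum_filter]
    apply Finset.sum_congr rfl; intro v _
    rw [Finset.sum_filter]
    split_ifs with h
    · simp [h]
    · simp [h]
  have key : ∑ v, ∑ w, f v ^ 2 * (σ v - σ w) ^ 2 * S.c v w ≤ A + 2 * A + 2 * S.En (S.B z (2 * s)) f := by
    nth_rewrite 2 [hA2]
    rw [hE, hA]
    simp only [Finset.mul_sum, ← Finset.sum_add_distrib]
    apply Finset.sum_le_sum; intro v _
    apply Finset.sum_le_sum; intro w _
    have hc := S.c_nonneg v w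
    have t1 : 0 ≤ f w ^ 2 * (σ v - σ w) ^ 2 * S.c v w := by positivity
    have t2 : 0 ≤ (f v - f w) ^ 2 * S.c v w := by positivity
    have q1 : 0 ≤ 2 * (if S.d z w ≤ s then f w ^ 2 * (σ v - σ w) ^ 2 * S.c v w else 0) := by
      split_ifs <;> linarith
    have q2 : 0 ≤ 2 * (if S.d z v ≤ 2 * s ∧ S.d z w ≤ 2 * s then (f v - f w) ^ 2 * S.c v w else 0) := by
      split_ifs <;> linarith
    by_cases hv : S.d z v ≤ s
    · rw [if_pos hv]; linarith
    · rw [if_neg hv]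
      push Not at hv
      by_cases hw : S.d z w ≤ s
      · by_cases hd : 1 < S.d v w
        · rw [S.c_dist v w hd]; simp
        · have := S.d_tri z w v
          rw [S.d_comm w v] at this
          rw [if_pos hw, if_pos ⟨by linarith, by linarith⟩]
          have hσ : (σ v - σ w) ^ 2 ≤ 1 := by
            have a1 := h0 v; have a2 := h0 w; have a3 := h1 v; have a4 := h1 w
            rw [sq_le_one_iff_abs_le_one, abs_le]; constructor <;> linarith
          have e1 : f v ^ 2 ≤ 2 * f w ^ 2 + 2 * (f v - f w) ^ 2 := by
            nlinarith [sq_nonneg (f v - 2 * f w)]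
          have e2 : f v ^ 2 * (σ v - σ w) ^ 2 ≤ 2 * f w ^ 2 * (σ v - σ w) ^ 2 + 2 * (f v - f w) ^ 2 := by
            nlinarith [mul_le_mul_of_nonneg_right e1 (sq_nonneg (σ v - σ w)),
              mul_le_mul_of_nonneg_left hσ (sq_nonneg (f v - f w))]
          nlinarith [mul_le_mul_of_nonneg_right e2 hc]
      · push Not at hw
        rw [h3 v hv, h3 w hw] at *
        simp only [sub_self] at *
        linarith
  linarith

/-- Annular cutoff functions. -/
lemma annulus (x : V) (s ρ : ℝ) (hs : 1 ≤ s) (hρ : s / 2 ≤ ρ) : ∃ φ : V → ℝ,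
    (∀ v, 0 ≤ φ v) ∧ (∀ v, φ v ≤ 1) ∧
    (∀ v, S.d x v ≤ ρ - s / 2 → φ v = 1) ∧ (∀ v, ρ + s < S.d x v → φ v = 0) ∧
    (∀ v w, φ v ≠ φ w → S.c v w ≠ 0 → ρ - 6 * s < S.d x v) ∧
    ∀ f : V → ℝ, ∑ v, ∑ w, f v ^ 2 * (φ v - φ w) ^ 2 * S.c v w ≤
      (3 * C2 + 2) * CD ^ 5 * (S.En (S.Ann x (ρ - 6 * s) (ρ + 2 * s)) f
        + s ^ (-θ) * ∑ v, f v ^ 2 * S.pi v) := by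
  obtain ⟨N, hN1, hN2⟩ := S.exists_net s (by linarith)
  choose σ h0 h1 h2 h3 h4 using fun z => S.cs_full z s hs
  set N' := N.filter (fun z => S.d x z ≤ ρ) with hN'
  have hne : N'.Nonempty := by
    obtain ⟨z, hz, hzx⟩ := hN1 x
    refine ⟨z, Finset.mem_filter.2 ⟨hz, ?_⟩⟩
    rw [S.d_comm]; linarith
  let φ : V → ℝ := fun v => N'.sup' hne (fun z => σ z v)
  have hle : ∀ v, ∀ z ∈ N', σ z v ≤ φ v := fun v z hz => Finset.le_sup' (fun z => σ z v) hz
  have hex : ∀ v, ∃ z ∈ N', φ v = σ z v := fun v => Finset.exists_mem_eq_sup' hne (fun z => σ z v)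
  have hφ0 : ∀ v, 0 ≤ φ v := by
    intro v; obtain ⟨z, _, h⟩ := hex v; rw [h]; exact h0 z v
  have hφ1 : ∀ v, φ v ≤ 1 := by
    intro v; obtain ⟨z, _, h⟩ := hex v; rw [h]; exact h1 z v
  have hφin : ∀ v, S.d x v ≤ ρ - s / 2 → φ v = 1 := by
    intro v hv
    obtain ⟨z, hz, hzv⟩ := hN1 v
    have hz' : z ∈ N' := by
      refine Finset.mem_filter.2 ⟨hz, ?_⟩
      have := S.d_tri x v z
      rw [S.d_comm v z] at this; linarith
    have := hle v z hz'
    rw [h2 z v hzv] at this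
    exact le_antisymm (hφ1 v) this
  have hφout : ∀ v, ρ + s < S.d x v → φ v = 0 := by
    intro v hv
    obtain ⟨z, hz, h⟩ := hex v
    rw [h]; apply h3
    have := S.d_tri x z v
    have := (Finset.mem_filter.1 hz).2
    linarith
  -- pairs with nonzero gradient
  have hloc : ∀ v w, φ v ≠ φ w → S.c v w ≠ 0 → ρ - s / 2 - 1 < S.d x v := by
    intro v w hvw hc
    by_contra hcon
    push Not at hcon
    have hd : S.d v w ≤ 1 := by
      by_contra h; push Not at h; exact hc (S.c_dist v w h)
    have := S.d_tri x v w
    apply hvw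
    rw [hφin v (by linarith), hφin w (by linarith)]
  set N2 := N.filter (fun z => ρ - 4 * s < S.d x z ∧ S.d x z ≤ ρ) with hN2'
  have hsum0 : ∀ v w, 0 ≤ ∑ z ∈ N2, (σ z v - σ z w) ^ 2 := fun v w =>
    Finset.sum_nonneg fun z _ => sq_nonneg _
  have hgrad1 : ∀ v w, φ w < φ v → S.c v w ≠ 0 → (φ v - φ w) ^ 2 ≤ ∑ z ∈ N2, (σ z v - σ z w) ^ 2 := by
    intro v w hlt hc
    obtain ⟨z, hz, h⟩ := hex v
    have hzw := hle w z hz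
    have hsq : (φ v - φ w) ^ 2 ≤ (σ z v - σ z w) ^ 2 := by
      rw [← h]
      apply pow_le_pow_left₀ (by linarith)
      linarith
    refine hsq.trans ?_
    have hzN2 : z ∈ N2 := by
      refine Finset.mem_filter.2 ⟨(Finset.mem_filter.1 hz).1, ?_, (Finset.mem_filter.1 hz).2⟩
      have hdv := hloc v w (ne_of_gt hlt) hc
      have hzv : S.d z v ≤ s := by
        by_contra hcon
        push Not at hcon
        have := h3 z v hcon
        have := hφ0 w
        linarith
      have := S.d_tri x z v
      linarith
    exact Finset.single_le_sum (f := fun z => (σ z v - σ z w) ^ 2) (fun z _ => sq_nonneg _) hzN2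
  have hgrad : ∀ v w, (φ v - φ w) ^ 2 * S.c v w ≤ (∑ z ∈ N2, (σ z v - σ z w) ^ 2) * S.c v w := by
    intro v w
    by_cases hc : S.c v w = 0
    · rw [hc]; simp
    apply mul_le_mul_of_nonneg_right _ (S.c_nonneg v w)
    rcases lt_trichotomy (φ w) (φ v) with h | h | h
    · exact hgrad1 v w h hc
    · rw [h]; simp only [sub_self, ne_eq, OfNat.ofNat_ne_zero, not_false_eq_true, zero_pow]
      exact hsum0 v w
    · have := hgrad1 w v h (by rwa [S.c_comm])
      calc (φ v - φ w) ^ 2 = (φ w - φ v) ^ 2 := by ring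
        _ ≤ _ := this
        _ = _ := Finset.sum_congr rfl fun z _ => by ring
  refine ⟨φ, hφ0, hφ1, hφin, hφout, fun v w h hc => by linarith [hloc v w h hc], fun f => ?_⟩
  have hC2 := S.hC2
  have hov : ∀ v, ((N2.filter (fun z => S.d z v ≤ 2 * s)).card : ℝ) ≤ CD ^ 5 := by
    intro v
    refine le_trans ?_ (hN2 v)
    norm_cast
    apply Finset.card_le_card
    apply Finset.filter_subset_filter
    exact Finset.filter_subset _ _
  have hsub : ∀ z ∈ N2, S.B z (2 * s) ⊆ S.Ann x (ρ - 6 * s) (ρ + 2 * s) := by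
    intro z hz v hv
    rw [mem_B] at hv
    obtain ⟨_, hz1, hz2⟩ := Finset.mem_filter.1 hz
    have t1 := S.d_tri x z v
    have t2 := S.d_tri x v z
    rw [S.d_comm v z] at t2
    simp only [Ann, Finset.mem_filter, Finset.mem_univ, true_and]
    constructor <;> linarith
  have hs0 : 0 ≤ s ^ (-θ) := Real.rpow_nonneg (by linarith) _
  calc ∑ v, ∑ w, f v ^ 2 * (φ v - φ w) ^ 2 * S.c v w
      ≤ ∑ v, ∑ w, ∑ z ∈ N2, f v ^ 2 * (σ z v - σ z w) ^ 2 * S.c v w := by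
        apply Finset.sum_le_sum; intro v _
        apply Finset.sum_le_sum; intro w _
        have := mul_le_mul_of_nonneg_left (hgrad v w) (sq_nonneg (f v))
        rw [Finset.sum_mul, Finset.mul_sum] at this
        simpa only [mul_assoc] using this
    _ = ∑ z ∈ N2, ∑ v, ∑ w, f v ^ 2 * (σ z v - σ z w) ^ 2 * S.c v w := by
        symm
        rw [Finset.sum_comm]
        apply Finset.sum_congr rfl; intro v _
        rw [Finset.sum_comm]
    _ ≤ ∑ z ∈ N2, (3 * C2 + 2) * (S.En (S.B z (2 * s)) f
        + s ^ (-θ) * ∑ v ∈ S.B z (2 * s), f v ^ 2 * S.pi v) :=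
        Finset.sum_le_sum fun z _ => h4 z f
    _ = (3 * C2 + 2) * (∑ z ∈ N2, S.En (S.B z (2 * s)) f
        + s ^ (-θ) * ∑ z ∈ N2, ∑ v ∈ S.B z (2 * s), f v ^ 2 * S.pi v) := by
        rw [← Finset.mul_sum, Finset.sum_add_distrib, Finset.mul_sum (a := s ^ (-θ))]
    _ ≤ (3 * C2 + 2) * (CD ^ 5 * S.En (S.Ann x (ρ - 6 * s) (ρ + 2 * s)) f
        + s ^ (-θ) * (CD ^ 5 * ∑ v, f v ^ 2 * S.pi v)) := by
        apply mul_le_mul_of_nonneg_left _ (by positivity)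
        apply add_le_add
        · exact S.overlap_En N2 _ _ hov _ hsub f
        · apply mul_le_mul_of_nonneg_left _ hs0
          exact S.overlap_sq N2 _ _ hov _ fun v => mul_nonneg (sq_nonneg _) (S.pi_nonneg v)
    _ = _ := by ring


lemma real_aux1 (δ a b : ℝ) (hδ : 0 < δ) (hδ1 : δ < 1) (hb : 0 ≤ b) (hab : b ≤ a) :
    2 * δ / (1 + δ) * (a ^ ((1 + δ) / 2) - b ^ ((1 + δ) / 2)) ^ 2 ≤ (a - b) * (a ^ δ - b ^ δ) := by
  rcases eq_or_lt_of_le (hb.trans hab) with h0 | ha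
  · have hb0 : b = 0 := by linarith
    subst hb0; rw [← h0]; simp
  obtain ⟨t, ht0, ht1, rfl⟩ : ∃ t : ℝ, 0 ≤ t ∧ t ≤ 1 ∧ b = t * a :=
    ⟨b / a, by positivity, by rw [div_le_one ha]; exact hab, by field_simp⟩
  rw [Real.mul_rpow ht0 ha.le, Real.mul_rpow ht0 ha.le]
  have hsq : (a ^ ((1 + δ) / 2)) ^ 2 = a * a ^ δ := by
    rw [← Real.rpow_natCast, ← Real.rpow_mul ha.le]
    have : (1 + δ) / 2 * ((2 : ℕ) : ℝ) = 1 + δ := by push_cast; ring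
    rw [this, Real.rpow_add ha, Real.rpow_one]
  have hu0 : 0 ≤ t ^ δ := Real.rpow_nonneg ht0 _
  have hbern := one_add_mul_self_le_rpow_one_add (s := t ^ δ - 1) (by linarith)
    (p := (1 + δ) / (2 * δ)) (by rw [le_div_iff₀ (by positivity)]; linarith)
  rw [add_sub_cancel, ← Real.rpow_mul ht0] at hbern
  have he : δ * ((1 + δ) / (2 * δ)) = (1 + δ) / 2 := by field_simp
  rw [he] at hbern
  have h1 : t ≤ t ^ ((1 + δ) / 2) := by
    rcases eq_or_lt_of_le ht0 with h | h
    · rw [← h]; exact Real.rpow_nonneg le_rfl _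
    · calc t = t ^ (1 : ℝ) := (Real.rpow_one t).symm
        _ ≤ _ := Real.rpow_le_rpow_of_exponent_ge h ht1 (by linarith)
  have h2 : t ^ ((1 + δ) / 2) ≤ 1 := Real.rpow_le_one ht0 ht1 (by positivity)
  set w := t ^ ((1 + δ) / 2) with hw
  have h3 : 2 * δ / (1 + δ) * (1 - w) ≤ 1 - t ^ δ := by
    have : 1 - w ≤ (1 + δ) / (2 * δ) * (1 - t ^ δ) := by linarith
    calc 2 * δ / (1 + δ) * (1 - w) ≤ 2 * δ / (1 + δ) * ((1 + δ) / (2 * δ) * (1 - t ^ δ)) := by gcongr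
      _ = _ := by field_simp
  have h4 : 2 * δ / (1 + δ) * (1 - w) * (1 - w) ≤ (1 - t ^ δ) * (1 - t) := by
    apply mul_le_mul h3 (by linarith) (by linarith)
    have : t ^ δ ≤ 1 := Real.rpow_le_one ht0 ht1 hδ.le
    linarith
  have h5 : 0 ≤ a * a ^ δ := by positivity
  calc 2 * δ / (1 + δ) * (a ^ ((1 + δ) / 2) - w * a ^ ((1 + δ) / 2)) ^ 2
      = (a ^ ((1 + δ) / 2)) ^ 2 * (2 * δ / (1 + δ) * (1 - w) * (1 - w)) := by ring
    _ ≤ (a * a ^ δ) * ((1 - t ^ δ) * (1 - t)) := by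
        rw [hsq]; exact mul_le_mul_of_nonneg_left h4 h5
    _ = _ := by ring

lemma real_sq (δ a : ℝ) (hδ : 0 < δ) (ha : 0 ≤ a) : (a ^ ((1 + δ) / 2)) ^ 2 = a ^ δ * a := by
  rw [← Real.rpow_natCast, ← Real.rpow_mul ha]
  have : (1 + δ) / 2 * ((2 : ℕ) : ℝ) = δ + 1 := by push_cast; ring
  rw [this]
  rcases eq_or_lt_of_le ha with h | h
  · rw [← h, Real.zero_rpow (by positivity)]; simp
  · rw [Real.rpow_add h, Real.rpow_one]

lemma real_aux2 (δ a b : ℝ) (hδ : 0 < δ) (hb : 0 ≤ b) (hab : b ≤ a) :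
    (a - b) * (a ^ δ + b ^ δ) ≤
      2 * ((a ^ ((1 + δ) / 2) - b ^ ((1 + δ) / 2)) * (a ^ ((1 + δ) / 2) + b ^ ((1 + δ) / 2))) := by
  have ha := hb.trans hab
  have e1 := real_sq δ a hδ ha
  have e2 := real_sq δ b hδ hb
  have h : b ^ δ ≤ a ^ δ := Real.rpow_le_rpow hb hab hδ.le
  have : 0 ≤ (a ^ δ - b ^ δ) * (a + b) := mul_nonneg (by linarith) (by linarith)
  nlinarith

lemma real_aux3 (δ m a b : ℝ) (hδ : 0 < δ) (hm : 0 < m) (hb : 0 ≤ b) (hab : b ≤ a) :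
    m ^ δ * (max a m - max b m) ≤
      (a ^ ((1 + δ) / 2) - b ^ ((1 + δ) / 2)) * (a ^ ((1 + δ) / 2) + b ^ ((1 + δ) / 2)) := by
  have ha := hb.trans hab
  have e1 := real_sq δ a hδ ha
  have e2 := real_sq δ b hδ hb
  have h : b ^ δ ≤ a ^ δ := Real.rpow_le_rpow hb hab hδ.le
  have hbd : 0 ≤ b ^ δ := Real.rpow_nonneg hb _
  have key : m ^ δ * (max a m - max b m) ≤ a ^ δ * a - b ^ δ * b := by
    rcases le_total a m with h1 | h1
    · rw [max_eq_right h1, max_eq_right (hab.trans h1)]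
      have := mul_le_mul h hab hb (hbd.trans h)
      linarith
    · rw [max_eq_left h1]
      have hma : m ^ δ ≤ a ^ δ := Real.rpow_le_rpow hm.le h1 hδ.le
      have hb' : b ≤ max b m := le_max_left _ _
      have hba : max b m ≤ a := max_le hab h1
      have s1 : m ^ δ * (a - max b m) ≤ a ^ δ * (a - max b m) :=
        mul_le_mul_of_nonneg_right hma (by linarith)
      have s2 : b ^ δ * b ≤ a ^ δ * max b m := mul_le_mul h hb' hb (hbd.trans h)
      linarith
  nlinarith

lemma real_cacc (k D1 D2 A Q : ℝ) (hk : 0 < k) (h1 : k * D2 ^ 2 ≤ A) (h2 : |D1| ≤ 2 * |D2 * Q|) (ψ ψ' : ℝ) :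
    k / 4 * ((ψ ^ 2 + ψ' ^ 2) * D2 ^ 2) - 2 / k * ((ψ - ψ') ^ 2 * Q ^ 2) ≤
      1 / 2 * (ψ ^ 2 + ψ' ^ 2) * A + 1 / 2 * (ψ ^ 2 - ψ' ^ 2) * D1 := by
  have hA : 1 / 2 * (ψ ^ 2 + ψ' ^ 2) * (k * D2 ^ 2) ≤ 1 / 2 * (ψ ^ 2 + ψ' ^ 2) * A :=
    mul_le_mul_of_nonneg_left h1 (by positivity)
  have hB : -(1 / 2 * (ψ ^ 2 - ψ' ^ 2) * D1) ≤ |(ψ + ψ') * D2| * |(ψ - ψ') * Q| := by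
    calc -(1 / 2 * (ψ ^ 2 - ψ' ^ 2) * D1) ≤ |1 / 2 * (ψ ^ 2 - ψ' ^ 2) * D1| := neg_le_abs _
      _ = 1 / 2 * |ψ ^ 2 - ψ' ^ 2| * |D1| := by rw [abs_mul, abs_mul]; norm_num
      _ ≤ 1 / 2 * |ψ ^ 2 - ψ' ^ 2| * (2 * |D2 * Q|) := by gcongr
      _ = |(ψ ^ 2 - ψ' ^ 2) * (D2 * Q)| := by rw [abs_mul (ψ ^ 2 - ψ' ^ 2)]; ring
      _ = |(ψ + ψ') * D2 * ((ψ - ψ') * Q)| := by congr 1; ring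
      _ = _ := abs_mul _ _
  have hC : |(ψ + ψ') * D2| * |(ψ - ψ') * Q| ≤ k / 8 * ((ψ + ψ') * D2) ^ 2 + 2 / k * ((ψ - ψ') * Q) ^ 2 := by
    rw [← sq_abs ((ψ + ψ') * D2), ← sq_abs ((ψ - ψ') * Q)]
    set X := |(ψ + ψ') * D2|
    set Y := |(ψ - ψ') * Q|
    have : 0 ≤ k / 8 * (X - 4 / k * Y) ^ 2 := by positivity
    have e : k / 8 * (X - 4 / k * Y) ^ 2 = k / 8 * X ^ 2 - X * Y + 2 / k * Y ^ 2 := by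
      field_simp; ring
    linarith
  have hD : k / 8 * ((ψ + ψ') * D2) ^ 2 ≤ k / 4 * ((ψ ^ 2 + ψ' ^ 2) * D2 ^ 2) := by
    have : 0 ≤ k / 8 * ((ψ - ψ') ^ 2 * D2 ^ 2) := by positivity
    nlinarith
  have hE : 2 / k * ((ψ - ψ') * Q) ^ 2 = 2 / k * ((ψ - ψ') ^ 2 * Q ^ 2) := by ring
  nlinarith

/-- `g` is the Green function with pole `x` killed at `y`. -/
structure Pole (x y : V) (g : V → ℝ) : Prop where
  nonneg : ∀ v, 0 ≤ g v
  zero : g y = 0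
  eq : ∀ h : V → ℝ, h y = 0 → ∑ v, ∑ w, (g v - g w) * (h v - h w) * S.c v w = 2 * h x

variable {S}

/-- Caccioppoli inequality. -/
lemma Pole.cacc {x y : V} {g : V → ℝ} (hg : S.Pole x y g) (δ : ℝ) (hδ : 0 < δ) (hδ1 : δ < 1)
    (ψ : V → ℝ) (hψ : ψ x = 0) (f : V → ℝ) (hf : ∀ v, f v = g v ^ ((1 + δ) / 2)) :
    (δ / (1 + δ)) ^ 2 * ∑ v, ∑ w, (ψ v ^ 2 + ψ w ^ 2) * (f v - f w) ^ 2 * S.c v w ≤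
      8 * ∑ v, ∑ w, f v ^ 2 * (ψ v - ψ w) ^ 2 * S.c v w := by
  set k := 2 * δ / (1 + δ) with hk
  have hkpos : 0 < k := by positivity
  have hpt : ∀ v w, k / 4 * ((ψ v ^ 2 + ψ w ^ 2) * (f v - f w) ^ 2)
      - 2 / k * ((ψ v - ψ w) ^ 2 * (f v + f w) ^ 2) ≤
      (g v - g w) * (ψ v ^ 2 * g v ^ δ - ψ w ^ 2 * g w ^ δ) := by
    intro v w
    have h1 : k * (f v - f w) ^ 2 ≤ (g v - g w) * (g v ^ δ - g w ^ δ) := by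
      rw [hf, hf]
      rcases le_total (g w) (g v) with h | h
      · exact real_aux1 δ _ _ hδ hδ1 (hg.nonneg w) h
      · have := real_aux1 δ _ _ hδ hδ1 (hg.nonneg v) h
        rw [← hk] at this
        nlinarith
    have hfn : ∀ v, 0 ≤ f v := fun v => by rw [hf]; exact Real.rpow_nonneg (hg.nonneg v) _
    have hgn : ∀ v, 0 ≤ g v ^ δ := fun v => Real.rpow_nonneg (hg.nonneg v) _
    have h2 : |(g v - g w) * (g v ^ δ + g w ^ δ)| ≤ 2 * |(f v - f w) * (f v + f w)| := by
      rw [abs_mul, abs_mul, abs_of_nonneg (add_nonneg (hgn v) (hgn w)),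
        abs_of_nonneg (add_nonneg (hfn v) (hfn w))]
      have hmono : ∀ a b, g a ≤ g b → f a ≤ f b := fun a b h => by
        rw [hf, hf]; exact Real.rpow_le_rpow (hg.nonneg a) h (by positivity)
      rcases le_total (g w) (g v) with h | h
      · have := real_aux2 δ _ _ hδ (hg.nonneg w) h
        rw [← hf, ← hf] at this
        rw [abs_of_nonneg (by linarith), abs_of_nonneg (by linarith [hmono _ _ h])]
        exact this
      · have := real_aux2 δ _ _ hδ (hg.nonneg v) h
        rw [← hf, ← hf] at this
        rw [abs_of_nonpos (by linarith), abs_of_nonpos (by linarith [hmono _ _ h])]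
        linarith
    have := real_cacc k _ _ _ _ hkpos h1 h2 (ψ v) (ψ w)
    nlinarith
  have hsum : ∑ v, ∑ w, (k / 4 * ((ψ v ^ 2 + ψ w ^ 2) * (f v - f w) ^ 2)
      - 2 / k * ((ψ v - ψ w) ^ 2 * (f v + f w) ^ 2)) * S.c v w ≤ 0 := by
    have h := hg.eq (fun v => ψ v ^ 2 * g v ^ δ) (by simp [hg.zero, Real.zero_rpow hδ.ne'])
    simp only [hψ] at h
    norm_num at h
    rw [← h]
    apply Finset.sum_le_sum; intro v _
    apply Finset.sum_le_sum; intro w _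
    exact mul_le_mul_of_nonneg_right (hpt v w) (S.c_nonneg v w)
  have hsw : ∑ v, ∑ w, f w ^ 2 * (ψ v - ψ w) ^ 2 * S.c v w
      = ∑ v, ∑ w, f v ^ 2 * (ψ v - ψ w) ^ 2 * S.c v w := by
    rw [Finset.sum_comm]
    apply Finset.sum_congr rfl; intro v _
    apply Finset.sum_congr rfl; intro w _
    rw [S.c_comm]; ring
  have hY : ∑ v, ∑ w, (ψ v - ψ w) ^ 2 * (f v + f w) ^ 2 * S.c v w ≤
      4 * ∑ v, ∑ w, f v ^ 2 * (ψ v - ψ w) ^ 2 * S.c v w := by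
    calc _ ≤ ∑ v, ∑ w, (2 * (f v ^ 2 * (ψ v - ψ w) ^ 2 * S.c v w)
          + 2 * (f w ^ 2 * (ψ v - ψ w) ^ 2 * S.c v w)) := by
          apply Finset.sum_le_sum; intro v _
          apply Finset.sum_le_sum; intro w _
          have : 0 ≤ (f v - f w) ^ 2 * (ψ v - ψ w) ^ 2 * S.c v w :=
            mul_nonneg (by positivity) (S.c_nonneg v w)
          nlinarith
      _ = 2 * ∑ v, ∑ w, f v ^ 2 * (ψ v - ψ w) ^ 2 * S.c v w
          + 2 * ∑ v, ∑ w, f w ^ 2 * (ψ v - ψ w) ^ 2 * S.c v w := by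
          simp only [Finset.sum_add_distrib, Finset.mul_sum]
      _ = _ := by rw [hsw]; ring
  have hsplit : ∑ v, ∑ w, (k / 4 * ((ψ v ^ 2 + ψ w ^ 2) * (f v - f w) ^ 2)
      - 2 / k * ((ψ v - ψ w) ^ 2 * (f v + f w) ^ 2)) * S.c v w
      = k / 4 * ∑ v, ∑ w, (ψ v ^ 2 + ψ w ^ 2) * (f v - f w) ^ 2 * S.c v w
        - 2 / k * ∑ v, ∑ w, (ψ v - ψ w) ^ 2 * (f v + f w) ^ 2 * S.c v w := by
    simp only [Finset.mul_sum, ← Finset.sum_sub_distrib]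
    apply Finset.sum_congr rfl; intro v _
    apply Finset.sum_congr rfl; intro w _
    ring
  rw [hsplit] at hsum
  set X := ∑ v, ∑ w, (ψ v ^ 2 + ψ w ^ 2) * (f v - f w) ^ 2 * S.c v w
  set Y := ∑ v, ∑ w, (ψ v - ψ w) ^ 2 * (f v + f w) ^ 2 * S.c v w
  have h1 : k / 4 * X ≤ 2 / k * Y := by linarith
  have h2 : k * (k / 4 * X) ≤ k * (2 / k * Y) := mul_le_mul_of_nonneg_left h1 hkpos.le
  have h3 : k * (2 / k * Y) = 2 * Y := by field_simp
  have h4 : (δ / (1 + δ)) ^ 2 = k * (k / 4) := by rw [hk]; ring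
  rw [h4]
  nlinarith

/-- One step of hole filling. -/
lemma Pole.hole {x y : V} {g : V → ℝ} (hg : S.Pole x y g) (δ : ℝ) (hδ : 0 < δ) (hδ1 : δ < 1)
    (f : V → ℝ) (hf : ∀ v, f v = g v ^ ((1 + δ) / 2)) (C : ℝ)
    (hC : C = 4 * (3 * C2 + 2) * CD ^ 5 / (δ / (1 + δ)) ^ 2)
    (s ρ : ℝ) (hs : 1 ≤ s) (hρ : s / 2 ≤ ρ) :
    (1 + C) * S.En (S.Ext x (ρ + 2 * s)) f ≤ C * S.En (S.Ext x (ρ - 6 * s)) f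
      + C * (s ^ (-θ) * ∑ v, f v ^ 2 * S.pi v) := by
  obtain ⟨φ, h0, h1, hin, hout, hloc, hcs⟩ := S.annulus x s ρ hs hρ
  have hca := hg.cacc δ hδ hδ1 (fun v => 1 - φ v)
    (by show 1 - φ x = 0; rw [hin x (by rw [S.d_self]; linarith)]; ring) f hf
  have hcf := hcs f
  have e1 : ∑ v, ∑ w, f v ^ 2 * ((1 - φ v) - (1 - φ w)) ^ 2 * S.c v w
      = ∑ v, ∑ w, f v ^ 2 * (φ v - φ w) ^ 2 * S.c v w := by
    apply Finset.sum_congr rfl; intro v _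
    apply Finset.sum_congr rfl; intro w _
    ring
  rw [e1] at hca
  have e2 : 2 * S.En (S.Ext x (ρ + 2 * s)) f ≤
      ∑ v, ∑ w, ((1 - φ v) ^ 2 + (1 - φ w) ^ 2) * (f v - f w) ^ 2 * S.c v w := by
    have hnn : ∀ v w, 0 ≤ ((1 - φ v) ^ 2 + (1 - φ w) ^ 2) * (f v - f w) ^ 2 * S.c v w :=
      fun v w => mul_nonneg (by positivity) (S.c_nonneg v w)
    calc _ = ∑ v ∈ S.Ext x (ρ + 2 * s), ∑ w ∈ S.Ext x (ρ + 2 * s),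
          ((1 - φ v) ^ 2 + (1 - φ w) ^ 2) * (f v - f w) ^ 2 * S.c v w := by
          unfold En
          rw [Finset.mul_sum]
          apply Finset.sum_congr rfl; intro v hv
          rw [Finset.mul_sum]
          apply Finset.sum_congr rfl; intro w hw
          simp only [Ext, Finset.mem_filter, Finset.mem_univ, true_and] at hv hw
          rw [hout v (by linarith), hout w (by linarith)]; ring
      _ ≤ ∑ v ∈ S.Ext x (ρ + 2 * s), ∑ w,
          ((1 - φ v) ^ 2 + (1 - φ w) ^ 2) * (f v - f w) ^ 2 * S.c v w :=
          Finset.sum_le_sum fun v _ => Finset.sum_le_sum_of_subset_of_nonneg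
            (Finset.subset_univ _) fun w _ _ => hnn v w
      _ ≤ _ := Finset.sum_le_sum_of_subset_of_nonneg (Finset.subset_univ _)
            fun v _ _ => Finset.sum_nonneg fun w _ => hnn v w
  have e3 : S.En (S.Ann x (ρ - 6 * s) (ρ + 2 * s)) f + S.En (S.Ext x (ρ + 2 * s)) f
      ≤ S.En (S.Ext x (ρ - 6 * s)) f := by
    apply S.En_add
    · intro v hv
      simp only [Ann, Ext, Finset.mem_filter, Finset.mem_univ, true_and] at *
      exact hv.1
    · intro v hv
      simp only [Ext, Finset.mem_filter, Finset.mem_univ, true_and] at *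
      linarith
    · rw [Finset.disjoint_left]
      intro v hv hv'
      simp only [Ann, Ext, Finset.mem_filter, Finset.mem_univ, true_and] at *
      linarith
  set q := (δ / (1 + δ)) ^ 2 with hq
  have hqpos : 0 < q := by positivity
  set T := S.En (S.Ann x (ρ - 6 * s) (ρ + 2 * s)) f
  set R := s ^ (-θ) * ∑ v, f v ^ 2 * S.pi v
  have hCq : q * C = 4 * ((3 * C2 + 2) * CD ^ 5) := by rw [hC]; field_simp
  have hCpos : 0 ≤ C := by
    rw [hC]; have := S.hC2; have := S.hCD; positivity
  have h5 : q * S.En (S.Ext x (ρ + 2 * s)) f ≤ q * (C * (T + R)) := by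
    have : q * (2 * S.En (S.Ext x (ρ + 2 * s)) f) ≤ _ := (mul_le_mul_of_nonneg_left e2 hqpos.le).trans hca
    rw [← mul_assoc, hCq]
    linarith
  have h6 := le_of_mul_le_mul_left h5 hqpos
  have h7 := mul_le_mul_of_nonneg_left e3 hCpos
  nlinarith

/-- Iterated hole filling. -/
lemma Pole.energy {x y : V} {g : V → ℝ} (hg : S.Pole x y g) (δ : ℝ) (hδ : 0 < δ) (hδ1 : δ < 1)
    (f : V → ℝ) (hf : ∀ v, f v = g v ^ ((1 + δ) / 2)) (C : ℝ)
    (hC : C = 4 * (3 * C2 + 2) * CD ^ 5 / (δ / (1 + δ)) ^ 2)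
    (η Q : ℝ) (hη0 : 0 < η) (hη1 : η < 1) (hQ4 : 4 ≤ Q)
    (hQ : C / (1 + C) * η ^ (-θ) * Q + 1 ≤ Q) :
    ∀ n : ℕ, ∀ s ρ : ℝ, 0 < s → s * η ^ n < 1 → 8 / (1 - η) * s ≤ ρ →
      S.En (S.Ext x ρ) f ≤ Q * (s ^ (-θ) * ∑ v, f v ^ 2 * S.pi v) := by
  have hS0 : 0 ≤ ∑ v, f v ^ 2 * S.pi v :=
    Finset.sum_nonneg fun v _ => mul_nonneg (sq_nonneg _) (S.pi_nonneg v)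
  have hθ := S.hθ
  have hsmall : ∀ s ρ : ℝ, 0 < s → s < 1 →
      S.En (S.Ext x ρ) f ≤ Q * (s ^ (-θ) * ∑ v, f v ^ 2 * S.pi v) := by
    intro s ρ hs hs1
    have h1 : 1 ≤ s ^ (-θ) := Real.one_le_rpow_of_pos_of_le_one_of_nonpos hs hs1.le (by linarith)
    calc _ ≤ 4 * ∑ v, f v ^ 2 * S.pi v := S.En_le _ f
      _ = 4 * (1 * ∑ v, f v ^ 2 * S.pi v) := by ring
      _ ≤ _ := by gcongr
  have hCpos : 0 ≤ C := by
    rw [hC]; have := S.hC2; have := S.hCD; positivity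
  intro n
  induction n with
  | zero => intro s ρ hs h _; exact hsmall s ρ hs (by simpa using h)
  | succ n ih =>
    intro s ρ hs h hρ
    by_cases hs1 : s < 1
    · exact hsmall s ρ hs hs1
    push Not at hs1
    have h8 : 8 * s ≤ ρ - 8 / (1 - η) * (η * s) := by
      have h1η : 0 < 1 - η := by linarith
      have : 8 / (1 - η) * s - 8 / (1 - η) * (η * s) = 8 * s := by field_simp
      linarith
    have hstep := hg.hole δ hδ hδ1 f hf C hC s (ρ - 2 * s) hs1 (by
      have : 0 ≤ 8 / (1 - η) * (η * s) := by
        have h1η : 0 < 1 - η := by linarith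
        positivity
      linarith)
    have hih := ih (η * s) (ρ - 2 * s - 6 * s) (by positivity) (by
      calc η * s * η ^ n = s * η ^ (n + 1) := by ring
        _ < 1 := h) (by linarith)
    rw [sub_add_cancel, Real.mul_rpow hη0.le hs.le] at *
    set I := ∑ v, f v ^ 2 * S.pi v
    set Z := s ^ (-θ) * I with hZ
    have hZ0 : 0 ≤ Z := mul_nonneg (Real.rpow_nonneg hs.le _) hS0
    have e : Q * (η ^ (-θ) * s ^ (-θ) * I) = Q * η ^ (-θ) * Z := by rw [hZ]; ring
    rw [e] at hih
    have h1C : 0 < 1 + C := by linarith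
    have hA : (1 + C) * S.En (S.Ext x ρ) f ≤ (1 + C) * (Q * Z) := by
      calc _ ≤ _ := hstep
        _ ≤ C * (Q * η ^ (-θ) * Z) + C * Z := by gcongr
        _ ≤ (1 + C) * ((C / (1 + C) * η ^ (-θ) * Q + 1) * Z) := by
            have : (1 + C) * ((C / (1 + C) * η ^ (-θ) * Q + 1) * Z)
              = C * (Q * η ^ (-θ) * Z) + (1 + C) * Z := by field_simp
            rw [this]; nlinarith
        _ ≤ _ := by gcongr
    exact le_of_mul_le_mul_left hA h1C


lemma clip_aux (t t' a b : ℝ) (h : b ≤ a) (ht : t ≤ t') :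
    max 0 (min b t' - t) ≤ max 0 (min a t' - t) ∧
      max 0 (min a t' - t) - max 0 (min b t' - t) ≤ a - b := by
  simp only [max_def, min_def]
  split_ifs <;> constructor <;> linarith

lemma clip_sq (t t' a b : ℝ) (ht : t ≤ t') :
    (max 0 (min a t' - t) - max 0 (min b t' - t)) ^ 2 ≤
      (a - b) * (max 0 (min a t' - t) - max 0 (min b t' - t)) := by
  rcases le_total b a with h | h
  · obtain ⟨h1, h2⟩ := clip_aux t t' a b h ht
    nlinarith
  · obtain ⟨h1, h2⟩ := clip_aux t t' b a h ht
    nlinarith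

lemma Pole.band {x y : V} {g : V → ℝ} (hg : S.Pole x y g) (t t' : ℝ) (ht0 : 0 ≤ t) (ht : t ≤ t') :
    S.En univ (fun v => max 0 (min (g v) t' - t)) ≤ 2 * (t' - t) := by
  have h := hg.eq (fun v => max 0 (min (g v) t' - t)) (by
    simp only [hg.zero]
    rw [min_eq_left (by linarith)]
    exact max_eq_left (by linarith))
  have hx : max 0 (min (g x) t' - t) ≤ t' - t := by
    apply max_le (by linarith)
    linarith [min_le_right (g x) t']
  calc _ ≤ ∑ v, ∑ w, (g v - g w) * (max 0 (min (g v) t' - t) - max 0 (min (g w) t' - t)) * S.c v w := by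
        unfold En
        apply Finset.sum_le_sum; intro v _
        apply Finset.sum_le_sum; intro w _
        exact mul_le_mul_of_nonneg_right (clip_sq t t' _ _ ht) (S.c_nonneg v w)
    _ = _ := h
    _ ≤ _ := by linarith

lemma level_pt (Λ δ m : ℝ) (hm : 0 < m) (hΛ : 2 ≤ Λ) (hδ : 0 < δ) (hΛδ : Λ ^ δ = 2) (a : ℝ) (ha : 0 ≤ a)
    (n : ℕ) : a ≤ Λ ^ (n + 1) * m → a ^ δ * a ≤ 2 * m ^ δ * a + ∑ k ∈ Finset.range n,
      2 ^ (k + 4) * m ^ δ / (Λ ^ k * m) *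
        (max 0 (min a (Λ ^ (k + 1) * m) - Λ ^ k * m)) ^ 2 := by
  have hpow : ∀ k : ℕ, (Λ ^ k * m) ^ δ = 2 ^ k * m ^ δ := by
    intro k
    rw [Real.mul_rpow (by positivity) hm.le, ← Real.rpow_natCast, ← Real.rpow_mul (by linarith),
      mul_comm (k : ℝ) δ, Real.rpow_mul (by linarith), hΛδ, Real.rpow_natCast]
  have hmδ : 0 < m ^ δ := Real.rpow_pos_of_pos hm _
  induction n with
  | zero =>
    intro h
    have h1 := Real.rpow_le_rpow ha h hδ.le
    rw [hpow] at h1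
    simp only [Finset.range_zero, Finset.sum_empty, add_zero]
    apply mul_le_mul_of_nonneg_right _ ha
    simpa using h1
  | succ n ih =>
    intro h
    rw [Finset.sum_range_succ]
    have hnn : ∀ k, 0 ≤ 2 ^ (k + 4) * m ^ δ / (Λ ^ k * m) *
        (max 0 (min a (Λ ^ (k + 1) * m) - Λ ^ k * m)) ^ 2 := fun k => by positivity
    by_cases h1 : a ≤ Λ ^ (n + 1) * m
    · linarith [ih h1, hnn n]
    · push Not at h1
      have hs := Finset.sum_nonneg (s := Finset.range n) fun k _ => hnn k
      have ht : 0 < Λ ^ n * m := by positivity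
      set τ := Λ ^ n * m with hτ
      have hΛ1 : Λ ^ (n + 1) * m = Λ * τ := by rw [hτ]; ring
      rw [hΛ1] at h1 ⊢
      have hmin : max 0 (min a (Λ * τ) - τ) = (Λ - 1) * τ := by
        rw [min_eq_right h1.le, max_eq_right]
        · ring
        · nlinarith
      rw [hmin]
      have h2 := Real.rpow_le_rpow ha h hδ.le
      rw [hpow] at h2
      have h3 : Λ ^ (n + 1 + 1) * m = Λ ^ 2 * τ := by rw [hτ]; ring
      rw [h3] at h
      have h4 : a ^ δ * a ≤ 2 ^ (n + 1 + 1) * m ^ δ * (Λ ^ 2 * τ) := by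
        apply mul_le_mul h2 h ha (by positivity)
      have h5 : Λ ^ 2 ≤ 4 * (Λ - 1) ^ 2 := by nlinarith
      have h6 : 2 ^ (n + 4) * m ^ δ / τ * ((Λ - 1) * τ) ^ 2
          = 2 ^ (n + 1 + 1) * m ^ δ * (4 * (Λ - 1) ^ 2 * τ) := by
        field_simp; ring
      rw [h6]
      have h7 : 2 ^ (n + 1 + 1) * m ^ δ * (Λ ^ 2 * τ) ≤ 2 ^ (n + 1 + 1) * m ^ δ * (4 * (Λ - 1) ^ 2 * τ) := by
        gcongr
      have h8 : 0 ≤ 2 * m ^ δ * a := by positivity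
      linarith

lemma vol_lower (S : Sys V θ CD CP C2) (D : ℝ) (hD : 0 < D) (hd : ∀ v w, S.d v w ≤ D) (z : V) (j : ℕ) :
    (CD ^ j)⁻¹ ≤ S.vl z (D / 2 ^ j) := by
  have h := S.vl_dbl z (r := D / 2 ^ j) (by positivity) j
  have e : (2 : ℝ) ^ j * (D / 2 ^ j) = D := by field_simp
  rw [e] at h
  have h1 : S.vl z D = 1 := by
    rw [← S.pi_sum]; unfold vl B
    rw [Finset.filter_true_of_mem]
    intro w _; exact hd z w
  rw [h1] at h
  have := S.hCD
  rw [inv_le_iff_one_le_mul₀ (by positivity)]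
  linarith

lemma Pole.level {x y : V} {g : V → ℝ} (hg : S.Pole x y g) (Λ δ m D : ℝ) (k0 : ℕ)
    (hm : 0 < m) (hΛ : 2 ≤ Λ) (hΛC : CD ≤ Λ) (hδ : 0 < δ) (hΛδ : Λ ^ δ = 2)
    (hD : 0 < D) (hd : ∀ v w, S.d v w ≤ D)
    (hH : ∑ v, g v * S.pi v ≤ m * (CD ^ k0)⁻¹ / 2) :
    ∑ v, g v ^ δ * g v * S.pi v ≤ 2 * m ^ δ * ∑ v, g v * S.pi v
      + 128 * CP * CD ^ 5 * Λ * (1 / 4) ^ k0 * m ^ δ * D ^ θ := by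
  set H := ∑ v, g v * S.pi v with hHdef
  have hCD := S.hCD
  have hCP := S.hCP
  have hθ := S.hθ
  have hmδ : 0 < m ^ δ := Real.rpow_pos_of_pos hm _
  obtain ⟨n, hn⟩ := pow_unbounded_of_one_lt ((∑ v, g v) / m) (by linarith : 1 < Λ)
  rw [div_lt_iff₀ hm] at hn
  have hgn : ∀ v, g v ≤ Λ ^ (n + 1) * m := by
    intro v
    have h1 : g v ≤ ∑ v, g v := Finset.single_le_sum (fun v _ => hg.nonneg v) (Finset.mem_univ v)
    have h2 : Λ ^ n * m ≤ Λ ^ (n + 1) * m := by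
      have : Λ ^ n ≤ Λ ^ (n + 1) := pow_le_pow_right₀ (by linarith) (by omega)
      gcongr
    linarith
  set b : ℕ → V → ℝ := fun k v => max 0 (min (g v) (Λ ^ (k + 1) * m) - Λ ^ k * m) with hb
  have hbk : ∀ k, ∑ v, b k v ^ 2 * S.pi v ≤
      2 * CP * CD ^ 5 * (D / 2 ^ (k0 + k)) ^ θ * (2 * (Λ * (Λ ^ k * m))) := by
    intro k
    have htk : 0 < Λ ^ k * m := by positivity
    have hfk := S.fk (D / 2 ^ (k0 + k)) (by positivity) (b k) (by
      intro z
      have h1 := S.vol_lower D hD hd z (k0 + k)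
      have h2 : (Λ ^ k * m) * ∑ v ∈ univ.filter (fun v => b k v ≠ 0), S.pi v ≤ H := by
        rw [Finset.mul_sum, hHdef]
        calc _ ≤ ∑ v ∈ univ.filter (fun v => b k v ≠ 0), g v * S.pi v := by
              apply Finset.sum_le_sum; intro v hv
              have hv := (Finset.mem_filter.1 hv).2
              apply mul_le_mul_of_nonneg_right _ (S.pi_nonneg v)
              by_contra hcon
              push Not at hcon
              apply hv
              rw [hb]
              apply max_eq_left
              linarith [min_le_left (g v) (Λ ^ (k + 1) * m)]
          _ ≤ _ := Finset.sum_le_sum_of_subset_of_nonneg (Finset.subset_univ _)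
              fun v _ _ => mul_nonneg (hg.nonneg v) (S.pi_nonneg v)
      have h3 : H ≤ (Λ ^ k * m) * ((CD ^ (k0 + k))⁻¹ / 2) := by
        refine hH.trans ?_
        have : 1 ≤ Λ ^ k * (CD ^ k)⁻¹ := by
          rw [← div_eq_mul_inv, one_le_div (by positivity)]
          exact pow_le_pow_left₀ (by linarith) hΛC k
        rw [pow_add, mul_inv]
        have h4 : 0 ≤ m * (CD ^ k0)⁻¹ / 2 := by positivity
        calc m * (CD ^ k0)⁻¹ / 2 = m * (CD ^ k0)⁻¹ / 2 * 1 := by ring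
          _ ≤ m * (CD ^ k0)⁻¹ / 2 * (Λ ^ k * (CD ^ k)⁻¹) := by gcongr
          _ = _ := by ring
      have h5 := le_of_mul_le_mul_left (h2.trans h3) htk
      linarith)
    refine hfk.trans ?_
    have hE := hg.band (Λ ^ k * m) (Λ ^ (k + 1) * m) htk.le (by
      have : Λ ^ k ≤ Λ ^ (k + 1) := pow_le_pow_right₀ (by linarith) (by omega)
      gcongr)
    have hE2 : S.En univ (b k) ≤ 2 * (Λ * (Λ ^ k * m)) := by
      refine hE.trans ?_
      have : Λ ^ (k + 1) * m = Λ * (Λ ^ k * m) := by ring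
      rw [this]; linarith
    gcongr
  have hterm : ∀ k, 2 ^ (k + 4) * m ^ δ / (Λ ^ k * m) * ∑ v, b k v ^ 2 * S.pi v ≤
      64 * CP * CD ^ 5 * Λ * (1 / 4) ^ k0 * m ^ δ * D ^ θ * (1 / 2) ^ k := by
    intro k
    have htk : 0 < Λ ^ k * m := by positivity
    have hr : (D / 2 ^ (k0 + k)) ^ θ ≤ D ^ θ * (1 / 4) ^ (k0 + k) := by
      rw [div_eq_mul_inv, Real.mul_rpow hD.le (by positivity)]
      apply mul_le_mul_of_nonneg_left _ (by positivity)
      calc (((2 : ℝ) ^ (k0 + k))⁻¹) ^ θ ≤ (((2 : ℝ) ^ (k0 + k))⁻¹) ^ (2 : ℝ) := by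
            apply Real.rpow_le_rpow_of_exponent_ge (by positivity) _ hθ
            apply inv_le_one_of_one_le₀
            exact one_le_pow₀ (by norm_num)
        _ = _ := by
            rw [Real.rpow_two, ← inv_pow, ← pow_mul, mul_comm, pow_mul]
            norm_num
    calc _ ≤ 2 ^ (k + 4) * m ^ δ / (Λ ^ k * m) *
          (2 * CP * CD ^ 5 * (D ^ θ * (1 / 4) ^ (k0 + k)) * (2 * (Λ * (Λ ^ k * m)))) := by
          apply mul_le_mul_of_nonneg_left _ (by positivity)
          refine (hbk k).trans ?_
          gcongr
      _ = 64 * CP * CD ^ 5 * Λ * (1 / 4) ^ k0 * m ^ δ * D ^ θ * (2 ^ k * (1 / 4) ^ k) := by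
          rw [pow_add (1 / 4 : ℝ), pow_add (2 : ℝ)]
          field_simp; ring
      _ = _ := by
          congr 1
          rw [← mul_pow]; norm_num
  calc _ ≤ ∑ v, (2 * m ^ δ * g v + ∑ k ∈ Finset.range n,
        2 ^ (k + 4) * m ^ δ / (Λ ^ k * m) * b k v ^ 2) * S.pi v := by
        apply Finset.sum_le_sum; intro v _
        apply mul_le_mul_of_nonneg_right _ (S.pi_nonneg v)
        exact level_pt Λ δ m hm hΛ hδ hΛδ (g v) (hg.nonneg v) n (hgn v)
    _ = 2 * m ^ δ * H + ∑ k ∈ Finset.range n,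
        2 ^ (k + 4) * m ^ δ / (Λ ^ k * m) * ∑ v, b k v ^ 2 * S.pi v := by
        simp only [add_mul, Finset.sum_add_distrib, Finset.sum_mul, Finset.mul_sum, hHdef]
        congr 1
        · apply Finset.sum_congr rfl; intro v _; ring
        · rw [Finset.sum_comm]
          apply Finset.sum_congr rfl; intro k _
          apply Finset.sum_congr rfl; intro v _; ring
    _ ≤ 2 * m ^ δ * H + ∑ k ∈ Finset.range n,
        64 * CP * CD ^ 5 * Λ * (1 / 4) ^ k0 * m ^ δ * D ^ θ * (1 / 2) ^ k := by
        exact add_le_add le_rfl (Finset.sum_le_sum fun k _ => hterm k)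
    _ ≤ 2 * m ^ δ * H + 64 * CP * CD ^ 5 * Λ * (1 / 4) ^ k0 * m ^ δ * D ^ θ * 2 := by
        rw [← Finset.mul_sum]
        have := sum_geometric_two_le n
        gcongr
    _ = _ := by ring

lemma Pole.lower {x y : V} {g : V → ℝ} (hg : S.Pole x y g) (δ : ℝ) (hδ : 0 < δ)
    (f : V → ℝ) (hf : ∀ v, f v = g v ^ ((1 + δ) / 2)) (A Q s ρ m : ℝ)
    (hA : A = (3 * C2 + 2) * CD ^ 5) (hQ : 0 ≤ Q)
    (hs : 1 ≤ s) (hρ : s / 2 ≤ ρ) (hxy : ρ + s < S.d x y) (hm : 0 < m) (hmA : 2 * A * m * s ^ (-θ) = 1)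
    (hen : S.En (S.Ext x (ρ - 6 * s)) f ≤ Q * (s ^ (-θ) * ∑ v, f v ^ 2 * S.pi v)) :
    m ^ δ ≤ 3 * A * (Q + 1) * (s ^ (-θ) * ∑ v, f v ^ 2 * S.pi v) := by
  obtain ⟨φ, h0, h1, hin, hout, hloc, hcs⟩ := S.annulus x s ρ hs hρ
  rw [← hA] at hcs
  have hA1 : 1 ≤ A := by
    rw [hA]
    have := one_le_pow₀ S.hCD (n := 5)
    have := S.hC2
    nlinarith
  have hfn : ∀ v, 0 ≤ f v := fun v => by rw [hf]; exact Real.rpow_nonneg (hg.nonneg v) _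
  have hmδ : 0 < m ^ δ := Real.rpow_pos_of_pos hm _
  have heq := hg.eq φ (hout y hxy)
  rw [hin x (by rw [S.d_self]; linarith)] at heq
  -- split
  have hsplit : ∑ v, ∑ w, (g v - g w) * (φ v - φ w) * S.c v w =
      ∑ v, ∑ w, (min (g v) m - min (g w) m) * (φ v - φ w) * S.c v w
      + ∑ v, ∑ w, (max (g v) m - max (g w) m) * (φ v - φ w) * S.c v w := by
    simp only [← Finset.sum_add_distrib]
    apply Finset.sum_congr rfl; intro v _
    apply Finset.sum_congr rfl; intro w _
    have e1 := min_add_max (g v) m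
    have e2 := min_add_max (g w) m
    have : g v - g w = (min (g v) m - min (g w) m) + (max (g v) m - max (g w) m) := by linarith
    rw [this]; ring
  have hEφ : ∑ v, ∑ w, (φ v - φ w) ^ 2 * S.c v w ≤ A * s ^ (-θ) := by
    have := hcs (fun _ => 1)
    simp only [one_pow, one_mul, S.pi_sum, mul_one, En, sub_self] at this
    simpa using this
  have hEm : ∑ v, ∑ w, (min (g v) m - min (g w) m) ^ 2 * S.c v w ≤ 2 * m := by
    have := hg.band 0 m le_rfl hm.le
    simp only [En, sub_zero] at this
    refine le_trans (le_of_eq ?_) this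
    apply Finset.sum_congr rfl; intro v _
    apply Finset.sum_congr rfl; intro w _
    rw [max_eq_right (le_min (hg.nonneg v) hm.le), max_eq_right (le_min (hg.nonneg w) hm.le)]
  have hfirst : ∑ v, ∑ w, (min (g v) m - min (g w) m) * (φ v - φ w) * S.c v w ≤ 1 := by
    calc _ ≤ ∑ v, ∑ w, (1 / (4 * m) * ((min (g v) m - min (g w) m) ^ 2 * S.c v w)
          + m * ((φ v - φ w) ^ 2 * S.c v w)) := by
          apply Finset.sum_le_sum; intro v _
          apply Finset.sum_le_sum; intro w _
          set X := min (g v) m - min (g w) m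
          set Y := φ v - φ w
          have : X * Y ≤ 1 / (4 * m) * X ^ 2 + m * Y ^ 2 := by
            have e : 1 / (4 * m) * X ^ 2 + m * Y ^ 2 - X * Y = 1 / (4 * m) * (X - 2 * m * Y) ^ 2 := by
              field_simp; ring
            have : 0 ≤ 1 / (4 * m) * (X - 2 * m * Y) ^ 2 := by positivity
            linarith
          have := mul_le_mul_of_nonneg_right this (S.c_nonneg v w)
          linarith
      _ = 1 / (4 * m) * ∑ v, ∑ w, (min (g v) m - min (g w) m) ^ 2 * S.c v w
          + m * ∑ v, ∑ w, (φ v - φ w) ^ 2 * S.c v w := by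
          simp only [Finset.sum_add_distrib, Finset.mul_sum]
      _ ≤ 1 / (4 * m) * (2 * m) + m * (A * s ^ (-θ)) := by gcongr
      _ = 1 := by
          have : m * (A * s ^ (-θ)) = 1 / 2 := by linarith
          rw [this]; field_simp; norm_num
  have hsecond : 1 ≤ ∑ v, ∑ w, (max (g v) m - max (g w) m) * (φ v - φ w) * S.c v w := by linarith
  set Z := s ^ (-θ) * ∑ v, f v ^ 2 * S.pi v with hZ
  have hZ0 : 0 ≤ Z := mul_nonneg (Real.rpow_nonneg (by linarith) _)
    (Finset.sum_nonneg fun v _ => mul_nonneg (sq_nonneg _) (S.pi_nonneg v))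
  have hT : ∑ v, ∑ w, f v ^ 2 * (φ v - φ w) ^ 2 * S.c v w ≤ A * (Q + 1) * Z := by
    have h := hcs f
    have h2 : S.En (S.Ann x (ρ - 6 * s) (ρ + 2 * s)) f ≤ S.En (S.Ext x (ρ - 6 * s)) f := by
      apply S.En_mono
      intro v hv
      simp only [Ann, Ext, Finset.mem_filter, Finset.mem_univ, true_and] at *
      exact hv.1
    calc _ ≤ _ := h
      _ ≤ A * (Q * Z + Z) := by gcongr; exact h2.trans hen
      _ = _ := by ring
  have hTs : ∑ v, ∑ w, f w ^ 2 * (φ v - φ w) ^ 2 * S.c v w ≤ A * (Q + 1) * Z := by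
    refine le_trans (le_of_eq ?_) hT
    rw [Finset.sum_comm]
    apply Finset.sum_congr rfl; intro v _
    apply Finset.sum_congr rfl; intro w _
    rw [S.c_comm]; ring
  have hEn : S.En (S.Ext x (ρ - 6 * s)) f = ∑ v, ∑ w,
      (if ρ - 6 * s < S.d x v ∧ ρ - 6 * s < S.d x w then (f v - f w) ^ 2 * S.c v w else 0) := by
    unfold En Ext
    rw [Finset.sum_filter]
    apply Finset.sum_congr rfl; intro v _
    rw [Finset.sum_filter]
    split_ifs with h
    · simp [h]
    · simp [h]
  have hpt : ∀ v w, m ^ δ * ((max (g v) m - max (g w) m) * (φ v - φ w) * S.c v w) ≤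
      1 / 2 * (if ρ - 6 * s < S.d x v ∧ ρ - 6 * s < S.d x w then (f v - f w) ^ 2 * S.c v w else 0)
      + (f v ^ 2 * (φ v - φ w) ^ 2 * S.c v w + f w ^ 2 * (φ v - φ w) ^ 2 * S.c v w) := by
    intro v w
    have hc := S.c_nonneg v w
    have hnn : 0 ≤ (if ρ - 6 * s < S.d x v ∧ ρ - 6 * s < S.d x w then (f v - f w) ^ 2 * S.c v w else 0) := by
      split_ifs
      · positivity
      · exact le_rfl
    have hnn2 : 0 ≤ f v ^ 2 * (φ v - φ w) ^ 2 * S.c v w + f w ^ 2 * (φ v - φ w) ^ 2 * S.c v w := by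
      positivity
    by_cases hφ : φ v = φ w
    · rw [hφ] at *; simp only [sub_self] at *; linarith
    by_cases hc0 : S.c v w = 0
    · rw [hc0] at *; simp
    rw [if_pos ⟨hloc v w hφ hc0, hloc w v (Ne.symm hφ) (by rwa [S.c_comm])⟩]
    have habs : m ^ δ * |max (g v) m - max (g w) m| ≤ |f v - f w| * (f v + f w) := by
      have hmono : ∀ a b, g a ≤ g b → f a ≤ f b := fun a b h => by
        rw [hf, hf]; exact Real.rpow_le_rpow (hg.nonneg a) h (by positivity)
      rcases le_total (g w) (g v) with h | h
      · have := real_aux3 δ m _ _ hδ hm (hg.nonneg w) h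
        rw [← hf, ← hf] at this
        rw [abs_of_nonneg (by linarith [max_le_max_right m h]), abs_of_nonneg (by linarith [hmono _ _ h])]
        exact this
      · have := real_aux3 δ m _ _ hδ hm (hg.nonneg v) h
        rw [← hf, ← hf] at this
        rw [abs_of_nonpos (by linarith [max_le_max_right m h]), abs_of_nonpos (by linarith [hmono _ _ h])]
        linarith
    have h3 : m ^ δ * ((max (g v) m - max (g w) m) * (φ v - φ w)) ≤
        |f v - f w| * (f v + f w) * |φ v - φ w| := by
      calc _ ≤ m ^ δ * |(max (g v) m - max (g w) m) * (φ v - φ w)| := by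
            gcongr; exact le_abs_self _
        _ = (m ^ δ * |max (g v) m - max (g w) m|) * |φ v - φ w| := by rw [abs_mul]; ring
        _ ≤ _ := by gcongr
    have h4 : |f v - f w| * (f v + f w) * |φ v - φ w| ≤
        1 / 2 * (f v - f w) ^ 2 + (f v ^ 2 * (φ v - φ w) ^ 2 + f w ^ 2 * (φ v - φ w) ^ 2) := by
      rw [← sq_abs (f v - f w), ← sq_abs (φ v - φ w)]
      set X := |f v - f w|
      set Y := |φ v - φ w|
      nlinarith [sq_nonneg (X - (f v + f w) * Y), mul_nonneg (sq_nonneg (f v - f w)) (sq_nonneg Y)]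
    have h5 := mul_le_mul_of_nonneg_right (h3.trans h4) hc
    linarith
  have hsum : m ^ δ * ∑ v, ∑ w, (max (g v) m - max (g w) m) * (φ v - φ w) * S.c v w ≤
      1 / 2 * S.En (S.Ext x (ρ - 6 * s)) f + (A * (Q + 1) * Z + A * (Q + 1) * Z) := by
    rw [hEn]
    refine le_trans ?_ (add_le_add_right (add_le_add hT hTs) _)
    simp only [Finset.mul_sum, ← Finset.sum_add_distrib]
    apply Finset.sum_le_sum; intro v _
    apply Finset.sum_le_sum; intro w _
    exact hpt v w
  have hQZ : Q * Z ≤ A * (Q + 1) * Z := by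
    apply mul_le_mul_of_nonneg_right _ hZ0
    nlinarith
  have hmm : m ^ δ * 1 ≤ m ^ δ * ∑ v, ∑ w, (max (g v) m - max (g w) m) * (φ v - φ w) * S.c v w := by
    gcongr
  have hAQZ : 0 ≤ A * (Q + 1) * Z := by positivity
  linarith

/-- Lower bound on the mass of the Green function, scale version. -/
lemma Pole.scale {x y : V} {g : V → ℝ} (hg : S.Pole x y g) (Λ δ C η Q A B0 W R : ℝ) (k0 : ℕ)
    (hΛ : 2 ≤ Λ) (hΛC : CD ≤ Λ) (hδ : 0 < δ) (hδ1 : δ < 1) (hΛδ : Λ ^ δ = 2)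
    (hC : C = 4 * (3 * C2 + 2) * CD ^ 5 / (δ / (1 + δ)) ^ 2)
    (hη0 : 0 < η) (hη1 : η < 1) (hQ4 : 4 ≤ Q)
    (hQ : C / (1 + C) * η ^ (-θ) * Q + 1 ≤ Q)
    (hA : A = (3 * C2 + 2) * CD ^ 5) (hB0 : B0 = 8 / (1 - η)) (hR : 0 ≤ R)
    (hW : W = 128 * CP * CD ^ 5 * Λ * R ^ θ)
    (hk0 : 3 * A * (Q + 1) * (W * (1 / 4) ^ k0) ≤ 1 / 2)
    (s D : ℝ) (hs : 1 ≤ s) (hxy : S.d x y = 2 * (B0 + 7) * s) (hD : 0 < D) (hDR : D ≤ R * s)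
    (hd : ∀ v w, S.d v w ≤ D) :
    min (1 / (12 * A * (Q + 1))) (1 / (4 * A * CD ^ k0)) * s ^ θ ≤ ∑ v, g v * S.pi v := by
  have hCD := S.hCD
  have hC2 := S.hC2
  have hCP := S.hCP
  have hθ := S.hθ
  have hA0 : 0 < A := by rw [hA]; positivity
  have hs0 : 0 < s := by linarith
  have hsθ : 0 < s ^ θ := Real.rpow_pos_of_pos hs0 _
  have hB0p : 0 < B0 := by rw [hB0]; have : 0 < 1 - η := by linarith
                           positivity
  set H := ∑ v, g v * S.pi v with hH
  set m := s ^ θ / (2 * A) with hm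
  have hm0 : 0 < m := by positivity
  have hinv : s ^ (-θ) = (s ^ θ)⁻¹ := Real.rpow_neg hs0.le θ
  by_cases hcase : H ≤ m * (CD ^ k0)⁻¹ / 2
  · have hlev := hg.level Λ δ m D k0 hm0 hΛ hΛC hδ hΛδ hD hd hcase
    rw [← hH] at hlev
    obtain ⟨n, hn⟩ := exists_pow_lt_of_lt_one (show 0 < 1 / s by positivity) hη1
    have hn' : s * η ^ n < 1 := by
      rw [lt_div_iff₀ hs0] at hn; linarith
    have hen := hg.energy δ hδ hδ1 (fun v => g v ^ ((1 + δ) / 2)) (fun v => rfl) C hC η Q hη0 hη1 hQ4 hQ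
      n s ((B0 + 7) * s - 6 * s) hs0 hn' (by rw [← hB0]; nlinarith)
    have hlow := hg.lower δ hδ (fun v => g v ^ ((1 + δ) / 2)) (fun v => rfl) A Q s ((B0 + 7) * s) m hA
      (by linarith) hs (by nlinarith) (by rw [hxy]; nlinarith) hm0
      (by rw [hinv, hm]; field_simp) hen
    have hsum : ∑ v, (g v ^ ((1 + δ) / 2)) ^ 2 * S.pi v = ∑ v, g v ^ δ * g v * S.pi v :=
      Finset.sum_congr rfl fun v _ => by rw [real_sq δ _ hδ (hg.nonneg v)]
    simp only [hsum] at hlow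
    have hDθ : D ^ θ ≤ R ^ θ * s ^ θ := by
      rw [← Real.mul_rpow hR hs0.le]
      exact Real.rpow_le_rpow hD.le hDR (by linarith)
    have hmδ : 0 < m ^ δ := Real.rpow_pos_of_pos hm0 _
    have h2 : ∑ v, g v ^ δ * g v * S.pi v ≤ m ^ δ * (2 * H + W * (1 / 4) ^ k0 * s ^ θ) := by
      calc _ ≤ _ := hlev
        _ ≤ 2 * m ^ δ * H + 128 * CP * CD ^ 5 * Λ * (1 / 4) ^ k0 * m ^ δ * (R ^ θ * s ^ θ) := by
            have : 0 ≤ Λ := by linarith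
            gcongr
        _ = _ := by rw [hW]; ring
    have h3 : m ^ δ * 1 ≤ m ^ δ * (3 * A * (Q + 1) * ((s ^ θ)⁻¹ * (2 * H + W * (1 / 4) ^ k0 * s ^ θ))) := by
      calc m ^ δ * 1 = m ^ δ := mul_one _
        _ ≤ _ := hlow
        _ ≤ 3 * A * (Q + 1) * (s ^ (-θ) * (m ^ δ * (2 * H + W * (1 / 4) ^ k0 * s ^ θ))) := by
            have : 0 ≤ s ^ (-θ) := by rw [hinv]; positivity
            have : 0 ≤ Q + 1 := by linarith
            gcongr
        _ = _ := by rw [hinv]; ring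
    have h4 := le_of_mul_le_mul_left h3 hmδ
    have e : 3 * A * (Q + 1) * ((s ^ θ)⁻¹ * (2 * H + W * (1 / 4) ^ k0 * s ^ θ))
        = 6 * A * (Q + 1) * H / s ^ θ + 3 * A * (Q + 1) * (W * (1 / 4) ^ k0) := by
      field_simp; ring
    rw [e] at h4
    have h5 : 1 / 2 ≤ 6 * A * (Q + 1) * H / s ^ θ := by linarith
    rw [le_div_iff₀ hsθ] at h5
    have hQ1 : 0 < Q + 1 := by linarith
    calc _ ≤ 1 / (12 * A * (Q + 1)) * s ^ θ := by gcongr; exact min_le_left _ _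
      _ ≤ H := by
        rw [div_mul_eq_mul_div, div_le_iff₀ (by positivity)]; linarith
  · push Not at hcase
    calc _ ≤ 1 / (4 * A * CD ^ k0) * s ^ θ := by gcongr; exact min_le_right _ _
      _ = m * (CD ^ k0)⁻¹ / 2 := by rw [hm]; field_simp; ring
      _ ≤ H := hcase.le

end
/-- Constants. -/
lemma bound (θ CD CP C2 c0 : ℝ) (hθ : 2 ≤ θ) (hCD : 1 ≤ CD) (hCP : 0 < CP) (hC2 : 0 < C2) (hc0 : 0 < c0) :
    ∃ c > (0 : ℝ), ∃ q > (0 : ℝ), ∀ (V : Type) [Fintype V] (S : Sys V θ CD CP C2) (x y : V) (g : V → ℝ)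
      (D : ℝ), S.Pole x y g → (∀ v w, S.d v w ≤ D) → 0 < D → c0 * D ≤ S.d x y → q ≤ S.d x y →
      c * D ^ θ ≤ ∑ v, g v * S.pi v := by
  obtain ⟨Λ, hΛ⟩ : ∃ Λ : ℝ, Λ = 4 * CD := ⟨_, rfl⟩
  have hΛ4 : 4 ≤ Λ := by linarith
  obtain ⟨δ, hδdef⟩ : ∃ δ : ℝ, δ = Real.logb Λ 2 := ⟨_, rfl⟩
  have hδ : 0 < δ := by rw [hδdef]; exact Real.logb_pos (by linarith) (by norm_num)
  have hΛδ : Λ ^ δ = 2 := by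
    rw [hδdef]; exact Real.rpow_logb (by linarith) (by linarith) (by norm_num)
  have hδ1 : δ < 1 := by
    rw [hδdef, Real.logb_lt_iff_lt_rpow (by linarith) (by norm_num), Real.rpow_one]; linarith
  obtain ⟨C, hC⟩ : ∃ C : ℝ, C = 4 * (3 * C2 + 2) * CD ^ 5 / (δ / (1 + δ)) ^ 2 := ⟨_, rfl⟩
  have hC0 : 0 < C := by rw [hC]; positivity
  obtain ⟨κ, hκ⟩ : ∃ κ : ℝ, κ = C / (1 + C) := ⟨_, rfl⟩
  have hκ0 : 0 < κ := by rw [hκ]; positivity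
  have hκ1 : κ < 1 := by rw [hκ, div_lt_one (by positivity)]; linarith
  obtain ⟨l, hl⟩ : ∃ l : ℝ, l = (κ + 1) / 2 := ⟨_, rfl⟩
  have hl0 : 0 < l := by linarith
  have hl1 : l < 1 := by linarith
  have hκl : κ < l := by linarith
  obtain ⟨η, hη⟩ : ∃ η : ℝ, η = l ^ (1 / θ) := ⟨_, rfl⟩
  have hη0 : 0 < η := by rw [hη]; exact Real.rpow_pos_of_pos hl0 _
  have hη1 : η < 1 := by rw [hη]; exact Real.rpow_lt_one hl0.le hl1 (by positivity)
  have hηθ : η ^ (-θ) = l⁻¹ := by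
    rw [hη, ← Real.rpow_mul hl0.le]
    have : 1 / θ * (-θ) = -1 := by field_simp
    rw [this, Real.rpow_neg_one]
  have hkl : κ / l < 1 := by rw [div_lt_one hl0]; exact hκl
  obtain ⟨Q, hQd⟩ : ∃ Q : ℝ, Q = max 4 (1 / (1 - κ / l)) := ⟨_, rfl⟩
  have hQ4 : 4 ≤ Q := by rw [hQd]; exact le_max_left _ _
  have hQ : C / (1 + C) * η ^ (-θ) * Q + 1 ≤ Q := by
    have h : 1 / (1 - κ / l) ≤ Q := by rw [hQd]; exact le_max_right _ _
    rw [div_le_iff₀ (by linarith)] at h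
    rw [hηθ, ← hκ, ← div_eq_mul_inv]; linarith
  obtain ⟨A, hA⟩ : ∃ A : ℝ, A = (3 * C2 + 2) * CD ^ 5 := ⟨_, rfl⟩
  have hA0 : 0 < A := by rw [hA]; positivity
  obtain ⟨B0, hB0⟩ : ∃ B0 : ℝ, B0 = 8 / (1 - η) := ⟨_, rfl⟩
  have hB0p : 0 < B0 := by
    rw [hB0]
    have : 0 < 1 - η := by linarith
    positivity
  obtain ⟨q, hq⟩ : ∃ q : ℝ, q = 2 * (B0 + 7) := ⟨_, rfl⟩
  have hq0 : 0 < q := by rw [hq]; positivity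
  obtain ⟨W, hW⟩ : ∃ W : ℝ, W = 128 * CP * CD ^ 5 * Λ * (q / c0) ^ θ := ⟨_, rfl⟩
  have hW0 : 0 < W := by
    have : 0 < (q / c0) ^ θ := Real.rpow_pos_of_pos (by positivity) _
    rw [hW]; positivity
  have hQ1 : 0 < Q + 1 := by linarith
  obtain ⟨k0, hk0⟩ := exists_pow_lt_of_lt_one
    (show 0 < 1 / (6 * A * (Q + 1) * W) by positivity) (show (1 / 4 : ℝ) < 1 by norm_num)
  have hk0' : 3 * A * (Q + 1) * (W * (1 / 4) ^ k0) ≤ 1 / 2 := by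
    rw [lt_div_iff₀ (by positivity)] at hk0
    linarith
  have hc1 : 0 < min (1 / (12 * A * (Q + 1))) (1 / (4 * A * CD ^ k0)) := by
    apply lt_min <;> positivity
  refine ⟨min (1 / (12 * A * (Q + 1))) (1 / (4 * A * CD ^ k0)) * (c0 / q) ^ θ,
    mul_pos hc1 (Real.rpow_pos_of_pos (by positivity) _), q, hq0, ?_⟩
  intro V _ S x y g D hg hd hD hcD hqd
  have h := hg.scale Λ δ C η Q A B0 W (q / c0) k0 (by linarith) (by linarith) hδ hδ1 hΛδ hC hη0 hη1 hQ4 hQ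
    hA hB0 (by positivity) hW hk0' (S.d x y / q) D (by rwa [le_div_iff₀ hq0, one_mul])
    (by rw [← hq]; field_simp) hD
    (by rw [div_mul_div_comm, le_div_iff₀ (by positivity)]; nlinarith) hd
  refine le_trans ?_ h
  rw [mul_assoc]
  refine mul_le_mul_of_nonneg_left ?_ hc1.le
  rw [← Real.mul_rpow (by positivity) hD.le]
  refine Real.rpow_le_rpow (by positivity) ?_ (by linarith)
  rw [div_mul_eq_mul_div]
  gcongr

end Sys

section
variable {V : Type} [Fintype V] [DecidableEq V]

lemma one_le_of_VD (G : SimpleGraph V) (K : V → V → ℝ) (pi : V → ℝ) (CD : ℝ) (x : V)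
    (hM : IsMarkovKernel G K pi) (h : CondVD G pi CD) : 1 ≤ CD := by
  obtain ⟨-, -, -, hpi, -⟩ := hM
  have h1 := h x 1 one_pos
  have h0 : 0 < vol G pi x 1 := Finset.sum_pos (fun w _ => hpi w) ⟨x, by simp [gball]⟩
  have h2 : vol G pi x 1 ≤ vol G pi x (2 * 1) := by
    apply Finset.sum_le_sum_of_subset_of_nonneg
    · intro w hw
      simp only [gball, mem_filter, mem_univ, true_and] at *
      linarith
    · intro w _ _; exact (hpi w).le
  have h3 : 1 * vol G pi x 1 ≤ CD * vol G pi x 1 := by linarith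
  exact le_of_mul_le_mul_right h3 h0

lemma adj_ite (G : SimpleGraph V) (K : V → V → ℝ) (pi : V → ℝ) (hM : IsMarkovKernel G K pi)
    (f : V → ℝ) (v w : V) :
    (if G.Adj v w then (f v - f w) ^ 2 * K v w * pi v else 0) = (f v - f w) ^ 2 * (pi v * K v w) := by
  obtain ⟨-, -, -, -, -, -, -, h0, -⟩ := hM
  split_ifs with h
  · ring
  · by_cases hvw : v = w
    · subst hvw; simp
    · rw [h0 v w hvw h]; simp

lemma clip01 (a b : ℝ) : (max 0 (min a 1) - max 0 (min b 1)) ^ 2 ≤ (a - b) ^ 2 := by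
  rw [sq_le_sq]
  calc |max 0 (min a 1) - max 0 (min b 1)| ≤ |min a 1 - min b 1| := abs_max_sub_max_le_abs _ _ _ |>.trans_eq' (by
        rw [max_comm 0, max_comm 0])
    _ ≤ |a - b| := abs_min_sub_min_le_max a 1 b 1 |>.trans (by simp)

/-- The abstract system attached to a Harnack Markov kernel. -/
noncomputable def mkSys (G : SimpleGraph V) (K : V → V → ℝ) (pi : V → ℝ) (θ p0 CD CP C1 C2 ε : ℝ)
    (hθ : 2 ≤ θ) (hCD : 1 ≤ CD) (hM : IsMarkovKernel G K pi) (hH : Harnack G K pi θ p0 CD CP C1 C2 ε) :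
    Sys V θ CD CP C2 where
  d v w := (G.dist v w : ℝ)
  c v w := pi v * K v w
  pi := pi
  d_self x := by simp
  d_comm x y := by rw [SimpleGraph.dist_comm]
  d_tri x y z := by exact_mod_cast hM.1.dist_triangle
  d_nonneg x y := by positivity
  c_nonneg x y := mul_nonneg (hM.2.2.2.1 x).le (hM.2.1 x y)
  c_comm x y := hM.2.2.2.2.2.1 x y
  c_sum x := by rw [← Finset.mul_sum, hM.2.2.1 x, mul_one]
  pi_pos := hM.2.2.2.1
  pi_sum := hM.2.2.2.2.1
  c_dist x y h := by
    have h1 : 1 < G.dist x y := by exact_mod_cast h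
    have hK := hM.2.2.2.2.2.2.2.1 x y (by rintro rfl; simp at h1)
      (fun ha => by rw [SimpleGraph.dist_eq_one_iff_adj.2 ha] at h1; omega)
    rw [hK, mul_zero]
  hθ := hθ
  hCD := hCD
  hCP := hH.2.2.1
  hC2 := hH.2.2.2.2.1
  vd := hH.2.2.2.2.2.2.2.1
  poin x r hr f := by
    have h := hH.2.2.2.2.2.2.2.2.1 x r hr f
    simp only [adj_ite G K pi hM, sq_abs] at h
    exact h
  cs x s hs := by
    obtain ⟨σ, h1, h2, -, h4⟩ := hH.2.2.2.2.2.2.2.2.2 x s hs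
    refine ⟨fun v => max 0 (min (σ v) 1), fun y => le_max_left _ _, fun y => ?_, fun y hy => ?_,
      fun y hy => ?_, fun f => ?_⟩
    · exact max_le zero_le_one (min_le_right _ _)
    · have := h1 y (by simpa [gball] using hy)
      simp [this]
    · have := h2 y (by simpa [gball] using hy)
      simp [this]
    · have h := h4 s hs le_rfl f
      simp only [adj_ite G K pi hM, sq_abs, div_self hs.ne', Real.one_rpow, mul_one] at h
      refine le_trans ?_ h
      refine Finset.sum_le_sum fun z _ => mul_le_mul_of_nonneg_left ?_ (sq_nonneg _)
      exact Finset.sum_le_sum fun w _ => mul_le_mul_of_nonneg_right (clip01 _ _)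
        (mul_nonneg (hM.2.2.2.1 z).le (hM.2.1 z w))

/-- Minimum principle. -/
lemma min_principle (G : SimpleGraph V) (K : V → V → ℝ) (pi : V → ℝ) (hM : IsMarkovKernel G K pi) (y : V)
    (u : V → ℝ) (hy : 0 ≤ u y) (hu : ∀ z, z ≠ y → ∑ w, K z w * u w ≤ u z) : ∀ z, 0 ≤ u z := by
  obtain ⟨hc, hK0, hK1, -, -, -, hadj, -⟩ := hM
  obtain ⟨z0, -, hz0⟩ := Finset.exists_min_image (univ : Finset V) u ⟨y, mem_univ _⟩
  have hmin : ∀ w, u z0 ≤ u w := fun w => hz0 w (mem_univ _)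
  by_contra! hneg
  obtain ⟨z1, hz1⟩ := hneg
  have hneg0 : u z0 < 0 := lt_of_le_of_lt (hmin z1) hz1
  have step : ∀ a b, G.Adj a b → u a = u z0 → u b = u z0 := by
    intro a b hab ha
    have hay : a ≠ y := by rintro rfl; linarith
    have h := hu a hay
    have hs : ∑ w, K a w * (u w - u z0) ≤ 0 := by
      simp only [mul_sub, Finset.sum_sub_distrib, ← Finset.sum_mul, hK1, one_mul]
      linarith
    have hb : K a b * (u b - u z0) ≤ ∑ w, K a w * (u w - u z0) :=
      Finset.single_le_sum (f := fun w => K a w * (u w - u z0))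
        (fun w _ => mul_nonneg (hK0 a w) (by linarith [hmin w])) (mem_univ b)
    have hp := hadj a b hab
    have := hmin b
    by_contra hne
    have hlt : 0 < u b - u z0 := by
      rcases lt_or_eq_of_le this with h | h
      · linarith
      · exact absurd h.symm hne
    have := mul_pos hp hlt
    linarith
  have all : ∀ a b, G.Walk a b → u a = u z0 → u b = u z0 := by
    intro a b p
    induction p with
    | nil => exact id
    | cons h _ ih => exact fun ha => ih (step _ _ h ha)
  obtain ⟨p⟩ := hc.preconnected z0 y
  have := all _ _ p rfl
  linarith

/-- Solvability of the Dirichlet problem. -/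
lemma dirichlet (G : SimpleGraph V) (K : V → V → ℝ) (pi : V → ℝ) (hM : IsMarkovKernel G K pi) (y : V)
    (φ : V → ℝ) : ∃ u : V → ℝ, u y = 0 ∧ ∀ z, z ≠ y → u z - ∑ w, K z w * u w = φ z := by
  let T : (V → ℝ) →ₗ[ℝ] (V → ℝ) :=
    { toFun := fun u z => if z = y then u y else u z - ∑ w, K z w * u w
      map_add' := by
        intro u v; ext z
        simp only [Pi.add_apply, mul_add, Finset.sum_add_distrib]
        split_ifs <;> ring
      map_smul' := by
        intro a u; ext z
        simp only [Pi.smul_apply, smul_eq_mul, RingHom.id_apply]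
        split_ifs
        · rfl
        · rw [mul_sub, Finset.mul_sum]
          congr 1
          exact Finset.sum_congr rfl fun w _ => by ring }
  have hT : ∀ u z, T u z = if z = y then u y else u z - ∑ w, K z w * u w := fun u z => rfl
  have hinj : Function.Injective T := by
    rw [← LinearMap.ker_eq_bot, LinearMap.ker_eq_bot']
    intro u hu
    have h0 : u y = 0 := by have := congrFun hu y; rw [hT] at this; simpa using this
    have h1 : ∀ z, z ≠ y → u z - ∑ w, K z w * u w = 0 := by
      intro z hz; have := congrFun hu z; rw [hT, if_neg hz] at this; simpa using this
    have a := min_principle G K pi hM y u h0.ge (fun z hz => by linarith [h1 z hz])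
    have b := min_principle G K pi hM y (fun z => - u z) (by simp [h0]) (fun z hz => by
      simp only [mul_neg, Finset.sum_neg_distrib]; linarith [h1 z hz])
    ext z
    have := a z
    have := b z
    simp only [Pi.zero_apply]; linarith
  obtain ⟨u, hu⟩ := (LinearMap.injective_iff_surjective.1 hinj) (fun z => if z = y then 0 else φ z)
  refine ⟨u, ?_, fun z hz => ?_⟩
  · have := congrFun hu y; rw [hT] at this; simpa using this
  · have := congrFun hu z; rw [hT, if_neg hz, if_neg hz] at this; exact this

lemma avoid_nonneg (K : V → V → ℝ) (hK : ∀ x y, 0 ≤ K x y) (y : V) (n : ℕ) : ∀ z, 0 ≤ avoid K y n z := by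
  induction n with
  | zero => intro z; simp only [avoid]; split_ifs <;> norm_num
  | succ n ih =>
    intro z; simp only [avoid]; split_ifs
    · exact le_rfl
    · exact Finset.sum_nonneg fun w _ => mul_nonneg (hK _ _) (ih w)

lemma avoid_self (K : V → V → ℝ) (y : V) (n : ℕ) : avoid K y n y = 0 := by
  cases n <;> simp [avoid]

lemma avoid_summable (G : SimpleGraph V) (K : V → V → ℝ) (pi : V → ℝ) (hM : IsMarkovKernel G K pi) (y z : V) :
    Summable (fun n => avoid K y n z) := by
  obtain ⟨u, hu0, hu⟩ := dirichlet G K pi hM y (fun _ => 1)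
  have hpos := min_principle G K pi hM y u hu0.ge (fun z hz => by linarith [hu z hz])
  have hle : ∀ N : ℕ, ∀ z, ∑ n ∈ Finset.range N, avoid K y n z ≤ u z := by
    intro N
    induction N with
    | zero => intro z; simpa using hpos z
    | succ N ih =>
      intro z
      by_cases hz : z = y
      · subst hz; simp [avoid_self, hu0]
      · rw [Finset.sum_range_succ']
        simp only [avoid, if_neg hz]
        rw [Finset.sum_comm]
        have : ∑ w, ∑ n ∈ Finset.range N, K z w * avoid K y n w ≤ ∑ w, K z w * u w := by
          refine Finset.sum_le_sum fun w _ => ?_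
          rw [← Finset.mul_sum]
          exact mul_le_mul_of_nonneg_left (ih w) (hM.2.1 z w)
        linarith [hu z hz]
  exact summable_of_sum_range_le (fun n => avoid_nonneg K hM.2.1 y n z) (fun N => hle N z)

lemma hit_self (K : V → V → ℝ) (y : V) : hit K y y = 0 := by
  simp [hit, avoid_self]

lemma hit_eq (G : SimpleGraph V) (K : V → V → ℝ) (pi : V → ℝ) (hM : IsMarkovKernel G K pi) (y z : V)
    (hz : z ≠ y) : hit K z y = 1 + ∑ w, K z w * hit K w y := by
  have hs := avoid_summable G K pi hM y
  unfold hit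
  rw [(hs z).tsum_eq_zero_add]
  simp only [avoid, if_neg hz]
  congr 1
  rw [Summable.tsum_finsetSum (fun w _ => (hs w).mul_left _)]
  exact Finset.sum_congr rfl fun w _ => tsum_mul_left

lemma hit_nonneg (G : SimpleGraph V) (K : V → V → ℝ) (pi : V → ℝ) (hM : IsMarkovKernel G K pi) (y z : V) :
    0 ≤ hit K z y := tsum_nonneg fun n => avoid_nonneg K hM.2.1 y n z

lemma one_le_hit (G : SimpleGraph V) (K : V → V → ℝ) (pi : V → ℝ) (hM : IsMarkovKernel G K pi) (y z : V)
    (hz : z ≠ y) : 1 ≤ hit K z y := by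
  rw [hit_eq G K pi hM y z hz]
  have : 0 ≤ ∑ w, K z w * hit K w y :=
    Finset.sum_nonneg fun w _ => mul_nonneg (hM.2.1 _ _) (hit_nonneg G K pi hM y w)
  linarith

/-- Dirichlet form and generator. -/
lemma green_id (G : SimpleGraph V) (K : V → V → ℝ) (pi : V → ℝ) (hM : IsMarkovKernel G K pi) (g h : V → ℝ) :
    ∑ v, ∑ w, (g v - g w) * (h v - h w) * (pi v * K v w) =
      2 * ∑ v, h v * (g v - ∑ w, K v w * g w) * pi v := by
  obtain ⟨-, -, hK1, -, -, hrev, -⟩ := hM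
  have e1 : ∑ v, h v * (g v - ∑ w, K v w * g w) * pi v =
      ∑ v, ∑ w, (g v - g w) * h v * (pi v * K v w) := by
    refine Finset.sum_congr rfl fun v _ => ?_
    have : g v = ∑ w, K v w * g v := by rw [← Finset.sum_mul, hK1, one_mul]
    conv_lhs => rw [this]
    rw [← Finset.sum_sub_distrib, Finset.mul_sum, Finset.sum_mul]
    exact Finset.sum_congr rfl fun w _ => by ring
  have e2 : ∑ v, ∑ w, (g v - g w) * h v * (pi v * K v w) =
      ∑ v, ∑ w, (g w - g v) * h w * (pi v * K v w) := by
    rw [Finset.sum_comm]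
    refine Finset.sum_congr rfl fun v _ => Finset.sum_congr rfl fun w _ => ?_
    rw [hrev v w]
  rw [e1, two_mul]
  conv_rhs => rw [add_comm]; lhs; rw [e2]
  rw [← Finset.sum_add_distrib]
  refine Finset.sum_congr rfl fun v _ => ?_
  rw [← Finset.sum_add_distrib]
  exact Finset.sum_congr rfl fun w _ => by ring

lemma exists_pole (G : SimpleGraph V) (K : V → V → ℝ) (pi : V → ℝ) (hM : IsMarkovKernel G K pi)
    (x y : V) (hxy : x ≠ y) : ∃ g : V → ℝ, (∀ v, 0 ≤ g v) ∧ g y = 0 ∧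
      (∀ h : V → ℝ, h y = 0 → ∑ v, ∑ w, (g v - g w) * (h v - h w) * (pi v * K v w) = 2 * h x) ∧
      ∑ v, g v * pi v = hit K x y := by
  have hpi := hM.2.2.2.1
  obtain ⟨g, hg0, hg⟩ := dirichlet G K pi hM y (fun z => if z = x then (pi x)⁻¹ else 0)
  have hpos := min_principle G K pi hM y g hg0.ge (fun z hz => by
    have h1 := hg z hz
    have h2 : 0 ≤ (if z = x then (pi x)⁻¹ else 0) := by
      split_ifs
      · exact (inv_pos.2 (hpi x)).le
      · exact le_rfl
    linarith)
  have hE : ∀ h : V → ℝ, h y = 0 →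
      ∑ v, ∑ w, (g v - g w) * (h v - h w) * (pi v * K v w) = 2 * h x := by
    intro h hy
    rw [green_id G K pi hM]
    congr 1
    rw [Finset.sum_eq_single x]
    · rw [hg x hxy, if_pos rfl, mul_assoc, inv_mul_cancel₀ (hpi x).ne', mul_one]
    · intro b _ hb
      by_cases hby : b = y
      · rw [hby, hy]; simp
      · rw [hg b hby, if_neg hb]; simp
    · simp
  refine ⟨g, hpos, hg0, hE, ?_⟩
  have h1 := hE (fun z => hit K z y) (hit_self K y)
  have h2 := green_id G K pi hM (fun z => hit K z y) g
  have h3 : ∑ v, ∑ w, (g v - g w) * (hit K v y - hit K w y) * (pi v * K v w) =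
      ∑ v, ∑ w, (hit K v y - hit K w y) * (g v - g w) * (pi v * K v w) :=
    Finset.sum_congr rfl fun v _ => Finset.sum_congr rfl fun w _ => by ring
  have h4 : ∑ v, g v * (hit K v y - ∑ w, K v w * hit K w y) * pi v = ∑ v, g v * pi v := by
    refine Finset.sum_congr rfl fun v _ => ?_
    by_cases hv : v = y
    · rw [hv, hg0]; simp
    · rw [hit_eq G K pi hM y v hv]; ring
  linarith

lemma dist_le_gdiam (G : SimpleGraph V) (v w : V) : G.dist v w ≤ gdiam G :=
  le_trans (Finset.le_sup (f := fun w => G.dist v w) (mem_univ w))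
    (Finset.le_sup (f := fun v => univ.sup fun w => G.dist v w) (mem_univ v))

end


/-- For a Harnack graph and `x,y` with `d(x,y) ≥ c₀ D`,
the expected hitting time satisfies `H(x,y) ≥ C D^θ`. -/
theorem stmt11 (θ p0 CD CP Ccs1 Ccs2 ε : ℝ) (hθ : 2 ≤ θ) (c0 : ℝ) (hc0 : 0 < c0) :
    ∃ C > (0 : ℝ),
      ∀ (V : Type) [Fintype V] [DecidableEq V],
        ∀ (G : SimpleGraph V) (K : V → V → ℝ) (pi : V → ℝ),
          IsMarkovKernel G K pi → Harnack G K pi θ p0 CD CP Ccs1 Ccs2 ε →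
          ∀ x y : V, c0 * (gdiam G : ℝ) ≤ (G.dist x y : ℝ) →
            C * (gdiam G : ℝ) ^ θ ≤ hit K x y := by
  by_cases hconst : 1 ≤ CD ∧ 0 < CP ∧ 0 < Ccs2
  · obtain ⟨hCD, hCP, hC2⟩ := hconst
    obtain ⟨c, hc, q, hq, hb⟩ := Sys.bound θ CD CP Ccs2 c0 hθ hCD hCP hC2 hc0
    refine ⟨min c ((c0 / q) ^ θ), lt_min hc (Real.rpow_pos_of_pos (by positivity) _), ?_⟩
    intro V _ _ G K pi hM hH x y hxy
    rcases Nat.eq_zero_or_pos (gdiam G) with hD | hD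
    · rw [hD, Nat.cast_zero, Real.zero_rpow (by linarith), mul_zero]
      exact hit_nonneg G K pi hM y x
    · have hD' : (0 : ℝ) < gdiam G := by exact_mod_cast hD
      have hne : x ≠ y := by
        rintro rfl
        have := mul_pos hc0 hD'
        simp at hxy
        linarith
      have hDθ : (0 : ℝ) < (gdiam G : ℝ) ^ θ := Real.rpow_pos_of_pos hD' _
      by_cases hqd : q ≤ (G.dist x y : ℝ)
      · obtain ⟨g, h1, h2, h3, h4⟩ := exists_pole G K pi hM x y hne
        rw [← h4]
        calc _ ≤ c * (gdiam G : ℝ) ^ θ := by gcongr; exact min_le_left _ _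
          _ ≤ _ := hb V (mkSys G K pi θ p0 CD CP Ccs1 Ccs2 ε hθ hCD hM hH) x y g (gdiam G)
            ⟨h1, h2, h3⟩ (fun v w => Nat.cast_le.2 (dist_le_gdiam G v w)) hD' hxy hqd
      · push Not at hqd
        calc _ ≤ (c0 / q) ^ θ * (gdiam G : ℝ) ^ θ := by gcongr; exact min_le_right _ _
          _ = (c0 / q * gdiam G) ^ θ := (Real.mul_rpow (by positivity) hD'.le).symm
          _ ≤ 1 := by
            refine Real.rpow_le_one (by positivity) ?_ (by linarith)
            rw [div_mul_eq_mul_div, div_le_one hq]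
            linarith
          _ ≤ _ := one_le_hit G K pi hM y x hne
  · refine ⟨1, one_pos, ?_⟩
    intro V _ _ G K pi hM hH x
    exact absurd ⟨one_le_of_VD G K pi CD x hM hH.2.2.2.2.2.2.2.1, hH.2.2.1, hH.2.2.2.2.1⟩ hconst
end

section
/- Fix α > 0. There exist constants c, C > 0 depending only on α such that for every integer N ≥ 2 the Metropolis birth-death chain on {0,1,…,N} with weights w_k = (1+k)^α satisfies: (i) c·N² ≤ H(0,N) ≤ C·N²; and (ii) c·M ≤ H(N,0) ≤ C·M, where M = N^{α+1} if α > 1, M = N²·log N if α = 1, and M = N² if 0 < α < 1. -/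
open Finset
open scoped Classical

variable {V : Type*} [Fintype V] [DecidableEq V]

/-- The weight function `w_k = (1+k)^α`. -/
noncomputable def bdW (α : ℝ) (k : ℕ) : ℝ := (1 + (k : ℝ)) ^ α

/-- The Metropolis birth-death chain on `{0,…,N}` with weights `w_k = (1+k)^α`:
`π(i) p_i = π(i+1) q_{i+1} = (1/2) min{π(i), π(i+1)}`. -/
noncomputable def bdK (N : ℕ) (α : ℝ) (i j : Fin (N + 1)) : ℝ :=
  if (j : ℕ) = (i : ℕ) + 1 then min (bdW α (i : ℕ)) (bdW α ((i : ℕ) + 1)) / (2 * bdW α (i : ℕ))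
  else if (i : ℕ) = (j : ℕ) + 1 then min (bdW α (j : ℕ)) (bdW α (i : ℕ)) / (2 * bdW α (i : ℕ))
  else if i = j then
    1 - (if (i : ℕ) < N then
          min (bdW α (i : ℕ)) (bdW α ((i : ℕ) + 1)) / (2 * bdW α (i : ℕ)) else 0) -
      (if 0 < (i : ℕ) then
          min (bdW α ((i : ℕ) - 1)) (bdW α (i : ℕ)) / (2 * bdW α (i : ℕ)) else 0)
  else 0

theorem hit_eq_of_poisson {V : Type*} [Fintype V] [DecidableEq V] (K : V → V → ℝ) (y : V)
    (h : V → ℝ) (hK : ∀ x z, 0 ≤ K x z) (h0 : ∀ x, 0 ≤ h x) (hy : h y = 0)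
    (hh : ∀ x, x ≠ y → h x = 1 + ∑ z, K x z * h z) (x : V) :
    hit K x y = h x := by
  obtain ⟨B, hB⟩ : ∃ B : ℝ, ∀ x, h x ≤ B := by
    refine ⟨∑ z, h z, fun x => ?_⟩
    exact Finset.single_le_sum (f := h) (fun i _ => h0 i) (Finset.mem_univ x)
  have hay : ∀ n, avoid K y n y = 0 := by
    intro n; cases n <;> simp [avoid]
  have ha0 : ∀ n x, 0 ≤ avoid K y n x := by
    intro n
    induction n with
    | zero => intro x; simp only [avoid]; split_ifs <;> norm_num
    | succ n ih =>
      intro x; simp only [avoid]; split_ifs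
      · exact le_rfl
      · exact Finset.sum_nonneg fun z _ => mul_nonneg (hK x z) (ih z)
  have hstep : ∀ n x, x ≠ y → ∑ k ∈ range (n+1), avoid K y k x
      = 1 + ∑ z, K x z * ∑ k ∈ range n, avoid K y k z := by
    intro n x hx
    rw [Finset.sum_range_succ']
    simp only [avoid, hx, if_false, Finset.mul_sum]
    rw [Finset.sum_comm, add_comm]
  have key : ∀ n x, ∑ k ∈ range n, avoid K y k x ≤ h x ∧
      h x ≤ ∑ k ∈ range n, avoid K y k x + B * avoid K y n x := by
    intro n
    induction n with
    | zero =>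
      intro x
      refine ⟨by simpa using h0 x, ?_⟩
      by_cases hx : x = y
      · subst hx; simp [hay, hy]
      · simpa [avoid, hx] using hB x
    | succ n ih =>
      intro x
      by_cases hx : x = y
      · subst hx; simp [hay, hy]
      · rw [hstep n x hx, hh x hx]
        constructor
        · gcongr with z
          · exact hK x z
          · exact (ih z).1
        · have : B * avoid K y (n+1) x = ∑ z, K x z * (B * avoid K y n z) := by
            simp only [avoid, hx, if_false, Finset.mul_sum]
            exact Finset.sum_congr rfl fun z _ => by ring
          rw [this, add_assoc, ← Finset.sum_add_distrib]
          gcongr with z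
          rw [← mul_add]
          exact mul_le_mul_of_nonneg_left (ih z).2 (hK x z)
  have hs : Summable fun n => avoid K y n x :=
    summable_of_sum_range_le (fun n => ha0 n x) (fun n => (key n x).1)
  have ht := hs.hasSum.tendsto_sum_nat
  have hz := hs.tendsto_atTop_zero
  have h1 : hit K x y ≤ h x := le_of_tendsto' ht fun n => (key n x).1
  have h2 : h x ≤ hit K x y + B * 0 :=
    ge_of_tendsto' (ht.add (hz.const_mul B)) fun n => (key n x).2
  linarith

theorem bdW_pos (α : ℝ) (k : ℕ) : 0 < bdW α k := by unfold bdW; positivity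

theorem bdW_mono {α : ℝ} (hα : 0 < α) {i j : ℕ} (h : i ≤ j) : bdW α i ≤ bdW α j := by
  unfold bdW
  have : (i:ℝ) ≤ j := by exact_mod_cast h
  gcongr

/-- down rate -/
noncomputable def bdq (α : ℝ) (i : ℕ) : ℝ := bdW α (i-1) / (2 * bdW α i)

theorem bdq_nonneg (α : ℝ) (i : ℕ) : 0 ≤ bdq α i := by
  have := bdW_pos α i
  have := bdW_pos α (i-1)
  unfold bdq; positivity

theorem bdq_le {α : ℝ} (hα : 0 < α) (i : ℕ) : bdq α i ≤ 1/2 := by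
  have := bdW_pos α i
  have := bdW_mono hα (Nat.sub_le i 1)
  unfold bdq
  rw [div_le_div_iff₀ (by positivity) (by norm_num)]
  linarith

theorem bdK_eq {α : ℝ} (hα : 0 < α) (N : ℕ) (i j : Fin (N+1)) :
    bdK N α i j = (if (j:ℕ) = i + 1 then 1/2 else 0) +
      (if (i:ℕ) = j + 1 then bdq α i else 0) +
      (if (j:ℕ) = i then
        1 - (if (i:ℕ) < N then 1/2 else 0) - (if 0 < (i:ℕ) then bdq α i else 0) else 0) := by
  have e1 : min (bdW α (i : ℕ)) (bdW α ((i : ℕ) + 1)) / (2 * bdW α (i : ℕ)) = 1/2 := by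
    rw [min_eq_left (bdW_mono hα (Nat.le_succ _))]
    have := bdW_pos α i
    field_simp
  have e2 : min (bdW α ((i:ℕ) - 1)) (bdW α (i : ℕ)) / (2 * bdW α (i : ℕ)) = bdq α i := by
    rw [min_eq_left (bdW_mono hα (Nat.sub_le _ _))]; rfl
  unfold bdK
  rw [e1, e2]
  by_cases h1 : (j:ℕ) = i + 1
  · have h2 : ¬ ((i:ℕ) = j + 1) := by omega
    have h3 : ¬ ((j:ℕ) = i) := by omega
    rw [if_pos h1, if_pos h1, if_neg h2, if_neg h3]; ring
  · by_cases h2 : (i:ℕ) = j + 1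
    · have h3 : ¬ ((j:ℕ) = i) := by omega
      have e3 : (j:ℕ) = (i:ℕ) - 1 := by omega
      rw [if_neg h1, if_neg h1, if_pos h2, if_pos h2, if_neg h3, e3, e2]
      ring
    · by_cases h3 : i = j
      · subst h3; simp
      · have h4 : ¬ ((j:ℕ) = i) := fun h => h3 (Fin.ext h.symm)
        simp [h1, h2, h3, h4]

theorem bdK_nonneg {α : ℝ} (hα : 0 < α) (N : ℕ) (i j : Fin (N+1)) : 0 ≤ bdK N α i j := by
  rw [bdK_eq hα]
  have h1 := bdq_nonneg α i
  have h2 := bdq_le hα i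
  split_ifs <;> linarith

theorem bdK_sum {α : ℝ} (hα : 0 < α) (N : ℕ) (i : Fin (N+1)) (f : ℕ → ℝ) :
    ∑ z : Fin (N+1), bdK N α i z * f z =
      f i + (if (i:ℕ) < N then 1/2 * (f (i+1) - f i) else 0)
        + (if 0 < (i:ℕ) then bdq α i * (f (i-1) - f i) else 0) := by
  simp only [bdK_eq hα, add_mul, Finset.sum_add_distrib]
  have s1 : ∑ z : Fin (N+1), (if (z:ℕ) = i + 1 then (1/2:ℝ) else 0) * f z
      = if (i:ℕ) < N then 1/2 * f (i+1) else 0 := by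
    rw [Fin.sum_univ_eq_sum_range (fun z => (if z = (i:ℕ) + 1 then (1/2:ℝ) else 0) * f z)]
    simp only [ite_mul, zero_mul, Finset.sum_ite_eq', Finset.mem_range, Nat.add_lt_add_iff_right]
  have s2 : ∑ z : Fin (N+1), (if (i:ℕ) = z + 1 then bdq α i else 0) * f z
      = if 0 < (i:ℕ) then bdq α i * f (i-1) else 0 := by
    rw [Fin.sum_univ_eq_sum_range (fun z => (if (i:ℕ) = z + 1 then bdq α i else 0) * f z)]
    have hi := i.2
    split_ifs with h
    · rw [Finset.sum_eq_single ((i:ℕ)-1)]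
      · rw [if_pos (by omega)]
      · intro b _ hb; rw [if_neg (by omega), zero_mul]
      · intro hb; exact absurd (Finset.mem_range.2 (by omega)) hb
    · apply Finset.sum_eq_zero
      intro b _; rw [if_neg (by omega), zero_mul]
  have s3 : ∀ d : ℝ, ∑ z : Fin (N+1), (if (z:ℕ) = i then d else 0) * f z = d * f i := by
    intro d
    rw [Fin.sum_univ_eq_sum_range (fun z => (if z = (i:ℕ) then d else 0) * f z)]
    simp only [ite_mul, zero_mul, Finset.sum_ite_eq', Finset.mem_range, i.2, if_true]
  rw [s1, s2, s3]
  split_ifs <;> ring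

noncomputable def bdD (α : ℝ) (k : ℕ) : ℝ := 2 / bdW α k * ∑ j ∈ range (k+1), bdW α j

noncomputable def bdE (α : ℝ) (N k : ℕ) : ℝ := 2 / bdW α k * ∑ j ∈ Ico (k+1) (N+1), bdW α j

theorem bdD_nonneg (α : ℝ) (k : ℕ) : 0 ≤ bdD α k :=
  mul_nonneg (div_nonneg zero_le_two (bdW_pos α k).le)
    (Finset.sum_nonneg fun j _ => (bdW_pos α j).le)

theorem bdE_nonneg (α : ℝ) (N k : ℕ) : 0 ≤ bdE α N k :=
  mul_nonneg (div_nonneg zero_le_two (bdW_pos α k).le)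
    (Finset.sum_nonneg fun j _ => (bdW_pos α j).le)

theorem hit_up {α : ℝ} (hα : 0 < α) (N : ℕ) :
    hit (bdK N α) (0 : Fin (N+1)) (Fin.last N) = ∑ k ∈ range N, bdD α k := by
  set f : ℕ → ℝ := fun i => ∑ k ∈ range N, bdD α k - ∑ k ∈ range i, bdD α k with hf
  have := hit_eq_of_poisson (bdK N α) (Fin.last N) (fun i => f i) (bdK_nonneg hα N)
    (fun i => ?_) (by simp [hf]) (fun i hi => ?_) 0
  · rw [this]; simp [hf]
  · have : (i:ℕ) ≤ N := by omega
    simp only [hf, sub_nonneg]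
    exact Finset.sum_le_sum_of_subset_of_nonneg (Finset.range_mono this)
      fun k _ _ => bdD_nonneg α k
  · have hiN : (i:ℕ) < N := by
      have := Fin.val_ne_iff.2 hi
      simp at this; omega
    rw [bdK_sum hα, if_pos hiN]
    generalize (i:ℕ) = m at *
    have e1 : f (m+1) - f m = - bdD α m := by
      simp only [hf, Finset.sum_range_succ]; ring
    rw [e1]
    cases m with
    | zero =>
      have := bdW_pos α 0
      simp [bdD]
      field_simp
      ring
    | succ m =>
      have e2 : f m - f (m+1) = bdD α m := by
        simp only [hf, Finset.sum_range_succ]; ring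
      have h1 := bdW_pos α (m+1)
      have h2 := bdW_pos α m
      rw [if_pos (Nat.succ_pos m), Nat.add_sub_cancel, e2]
      simp only [bdD, bdq, Nat.add_sub_cancel]
      rw [Finset.sum_range_succ _ (m+1)]
      field_simp
      ring

theorem hit_down {α : ℝ} (hα : 0 < α) (N : ℕ) :
    hit (bdK N α) (Fin.last N) (0 : Fin (N+1)) = ∑ k ∈ range N, bdE α N k := by
  set f : ℕ → ℝ := fun i => ∑ k ∈ range i, bdE α N k with hf
  have := hit_eq_of_poisson (bdK N α) 0 (fun i => f i) (bdK_nonneg hα N)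
    (fun i => Finset.sum_nonneg fun k _ => bdE_nonneg α N k) (by simp [hf]) (fun i hi => ?_)
    (Fin.last N)
  · rw [this]; simp [hf]
  · have hi0 : (i:ℕ) ≠ 0 := fun h => hi (Fin.ext (by simpa using h))
    have hiN : (i:ℕ) ≤ N := by omega
    rw [bdK_sum hα]
    generalize (i:ℕ) = m at *
    obtain ⟨m, rfl⟩ := Nat.exists_eq_succ_of_ne_zero hi0
    simp only [Nat.succ_eq_add_one] at *
    have e0 : (if m+1 < N then 1/2 * (f (m+1+1) - f (m+1)) else 0) = 1/2 * bdE α N (m+1) := by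
      split_ifs with h
      · simp only [hf, Finset.sum_range_succ]; ring
      · have : m + 1 = N := by omega
        simp [bdE, this]
    have e2 : f m - f (m+1) = - bdE α N m := by
      simp only [hf, Finset.sum_range_succ]; ring
    have h1 := bdW_pos α (m+1)
    have h2 := bdW_pos α m
    rw [e0, if_pos (Nat.succ_pos m), Nat.add_sub_cancel, e2]
    simp only [bdE, bdq, Nat.add_sub_cancel]
    rw [Finset.sum_eq_sum_Ico_succ_bot (show m+1 < N+1 by omega)]
    field_simp
    ring

theorem sum_bdW_le {α : ℝ} (hα : 0 < α) (k : ℕ) :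
    ∑ j ∈ range (k+1), bdW α j ≤ (k+1) * bdW α k := by
  calc _ ≤ ∑ j ∈ range (k+1), bdW α k :=
        Finset.sum_le_sum fun j hj => bdW_mono hα (by have := Finset.mem_range.1 hj; omega)
    _ = _ := by simp

/-- `n^{a+1} - (n-1)^{a+1} ≤ (a+1) n^a`. -/
theorem rpow_step {α : ℝ} (hα : 0 < α) (k : ℕ) :
    ((k:ℝ)+1)^(α+1) - (k:ℝ)^(α+1) ≤ (α+1) * ((k:ℝ)+1)^α := by
  have hp : (0:ℝ) < (k:ℝ)+1 := by positivity
  have hb := one_add_mul_self_le_rpow_one_add (s := -1/((k:ℝ)+1)) (p := α+1)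
    (by rw [le_div_iff₀ hp]; linarith) (by linarith)
  have e : 1 + -1/((k:ℝ)+1) = (k:ℝ)/((k:ℝ)+1) := by field_simp; ring
  rw [e, Real.div_rpow (by positivity) hp.le, le_div_iff₀ (by positivity)] at hb
  rw [Real.rpow_add_one hp.ne'] at hb ⊢
  have : (1 + (α+1) * (-1/((k:ℝ)+1))) * (((k:ℝ)+1)^α * ((k:ℝ)+1))
     = ((k:ℝ)+1)^α * ((k:ℝ)+1) - (α+1) * ((k:ℝ)+1)^α := by field_simp; ring
  rw [this] at hb
  linarith

theorem le_sum_bdW {α : ℝ} (hα : 0 < α) (n : ℕ) :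
    (n:ℝ)^(α+1) ≤ (α+1) * ∑ j ∈ range n, bdW α j := by
  induction n with
  | zero => simp [Real.zero_rpow (by linarith : α+1 ≠ 0)]
  | succ n ih =>
    rw [Finset.sum_range_succ]
    have := rpow_step hα n
    have e : bdW α n = ((n:ℝ)+1)^α := by unfold bdW; rw [add_comm]
    push_cast
    rw [e]; linarith

theorem bound_up {α : ℝ} (hα : 0 < α) (N : ℕ) :
    1/(α+1) * (N:ℝ)^2 ≤ ∑ k ∈ range N, bdD α k ∧ ∑ k ∈ range N, bdD α k ≤ 2 * (N:ℝ)^2 := by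
  have ha : 0 < α + 1 := by linarith
  constructor
  · induction N with
    | zero => simp
    | succ n ih =>
      rw [Finset.sum_range_succ]
      have h1 := le_sum_bdW hα (n+1)
      have h2 := bdW_pos α n
      have e : bdW α n = ((n:ℝ)+1)^α := by unfold bdW; rw [add_comm]
      push_cast at h1 ⊢
      rw [Real.rpow_add_one (by positivity), ← e] at h1
      have h3 : 2 * ((n:ℝ)+1) / (α+1) ≤ bdD α n := by
        unfold bdD
        rw [div_mul_eq_mul_div, div_le_div_iff₀ ha h2]
        linarith
      have h4 : 1/(α+1) * ((n:ℝ)+1)^2 ≤ 1/(α+1) * (n:ℝ)^2 + 2 * ((n:ℝ)+1) / (α+1) := by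
        have : 1/(α+1) * (n:ℝ)^2 + 2 * ((n:ℝ)+1) / (α+1) - 1/(α+1) * ((n:ℝ)+1)^2 = 1/(α+1) := by
          field_simp; ring
        have : 0 < 1/(α+1) := by positivity
        linarith
      linarith
  · calc _ ≤ ∑ k ∈ range N, 2 * (N:ℝ) := by
          refine Finset.sum_le_sum fun k hk => ?_
          have hk : k + 1 ≤ N := Finset.mem_range.1 hk
          have hk' : (k:ℝ) + 1 ≤ N := by exact_mod_cast hk
          have := sum_bdW_le hα k
          have h2 := bdW_pos α k
          unfold bdD
          rw [div_mul_eq_mul_div, div_le_iff₀ h2]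
          nlinarith
      _ = _ := by simp; ring

theorem bdE_le {α : ℝ} (hα : 0 < α) (N k : ℕ) (hN : 1 ≤ N) :
    bdE α N k ≤ 2 ^ (α+2) * (N:ℝ)^(α+1) * ((1+(k:ℝ))^α)⁻¹ := by
  have h2 := bdW_pos α k
  have hN' : (1:ℝ) ≤ N := by exact_mod_cast hN
  have h1 : ∑ j ∈ Ico (k+1) (N+1), bdW α j ≤ (2*(N:ℝ))^(α+1) := by
    calc _ ≤ ∑ j ∈ range (N+1), bdW α j :=
          Finset.sum_le_sum_of_subset_of_nonneg
            (fun x hx => Finset.mem_range.2 (Finset.mem_Ico.1 hx).2) fun j _ _ => (bdW_pos α j).le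
      _ ≤ _ := sum_bdW_le hα N
      _ = (1+(N:ℝ))^(α+1) := by
          unfold bdW; rw [Real.rpow_add_one (by positivity)]; ring
      _ ≤ _ := by
          apply Real.rpow_le_rpow <;> linarith
  unfold bdE
  have e : (2:ℝ)^(α+2) = 2 * 2^(α+1) := by
    rw [show α+2 = (α+1)+1 by ring, Real.rpow_add_one (by norm_num) (α+1)]; ring
  rw [Real.mul_rpow (by norm_num) (by linarith)] at h1
  rw [e]
  calc _ ≤ 2 / bdW α k * (2^(α+1) * (N:ℝ)^(α+1)) := by gcongr
    _ = _ := by unfold bdW; rw [div_eq_mul_inv]; ring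

theorem sum_bdE_le {α : ℝ} (hα : 0 < α) (N : ℕ) (hN : 1 ≤ N) :
    ∑ k ∈ range N, bdE α N k ≤
      2 ^ (α+2) * (N:ℝ)^(α+1) * ∑ k ∈ range N, ((1+(k:ℝ))^α)⁻¹ := by
  rw [Finset.mul_sum]
  exact Finset.sum_le_sum fun k _ => bdE_le hα N k hN

theorem bound_down_gt {α : ℝ} (hα : 1 < α) : ∃ c > (0:ℝ), ∃ C > (0:ℝ), ∀ N : ℕ, 2 ≤ N →
    c * (N:ℝ)^(α+1) ≤ ∑ k ∈ range N, bdE α N k ∧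
    ∑ k ∈ range N, bdE α N k ≤ C * (N:ℝ)^(α+1) := by
  have hα0 : 0 < α := by linarith
  have hs : Summable fun k : ℕ => ((1+(k:ℝ))^α)⁻¹ := by
    have := (summable_nat_add_iff 1).2 (Real.summable_nat_rpow_inv.2 hα)
    refine this.congr fun k => ?_
    push_cast; rw [add_comm]
  have hnn : ∀ k : ℕ, 0 ≤ ((1+(k:ℝ))^α)⁻¹ := fun k => by positivity
  have hpos : 0 < ∑' k : ℕ, ((1+(k:ℝ))^α)⁻¹ := hs.tsum_pos hnn 0 (by simp)
  refine ⟨2/(α+1), by positivity, 2^(α+2) * ∑' k : ℕ, ((1+(k:ℝ))^α)⁻¹, by positivity,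
    fun N hN => ⟨?_, ?_⟩⟩
  · have h1 : bdE α N 0 ≤ ∑ k ∈ range N, bdE α N k :=
      Finset.single_le_sum (f := fun k => bdE α N k) (fun k _ => bdE_nonneg α N k)
        (Finset.mem_range.2 (by omega))
    refine le_trans ?_ h1
    have h2 : ∑ j ∈ range N, bdW α j ≤ ∑ j ∈ Ico (0+1) (N+1), bdW α j := by
      rw [Finset.sum_Ico_eq_sum_range]
      refine Finset.sum_le_sum fun j _ => bdW_mono hα0 (by omega)
    have h3 := le_sum_bdW hα0 N
    have e : bdW α 0 = 1 := by simp [bdW]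
    unfold bdE
    rw [e, div_one, div_mul_eq_mul_div, div_le_iff₀ (by linarith)]
    nlinarith
  · refine (sum_bdE_le hα0 N (by omega)).trans ?_
    have := hs.sum_le_tsum (range N) (fun k _ => hnn k)
    calc _ ≤ 2 ^ (α+2) * (N:ℝ)^(α+1) * ∑' k : ℕ, ((1+(k:ℝ))^α)⁻¹ := by gcongr
      _ = _ := by ring

theorem sum_rpow_inv_le {α : ℝ} (hα : 0 < α) (h1 : α < 1) (N : ℕ) :
    (1-α) * ∑ k ∈ range N, ((1+(k:ℝ))^α)⁻¹ ≤ (N:ℝ)^(1-α) := by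
  have hb : 0 < 1 - α := by linarith
  induction N with
  | zero => simp [Real.zero_rpow hb.ne']
  | succ n ih =>
    rw [Finset.sum_range_succ, mul_add]
    have hp : (0:ℝ) < (n:ℝ)+1 := by positivity
    have key := rpow_one_add_le_one_add_mul_self (s := -1/((n:ℝ)+1)) (p := 1-α)
      (by rw [le_div_iff₀ hp]; linarith) hb.le (by linarith)
    have e : 1 + -1/((n:ℝ)+1) = (n:ℝ)/((n:ℝ)+1) := by field_simp; ring
    rw [e, Real.div_rpow (by positivity) hp.le, div_le_iff₀ (by positivity)] at key
    have e2 : ((n:ℝ)+1)^(1-α) = ((n:ℝ)+1) * (((n:ℝ)+1)^α)⁻¹ := by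
      rw [Real.rpow_sub hp, Real.rpow_one, div_eq_mul_inv]
    have e3 : (1 + (1-α) * (-1/((n:ℝ)+1))) * ((n:ℝ)+1)^(1-α)
       = ((n:ℝ)+1)^(1-α) - (1-α) * (((n:ℝ)+1)^α)⁻¹ := by
      rw [e2]; field_simp; ring
    rw [e3] at key
    push_cast
    rw [add_comm (1:ℝ) (n:ℝ)]
    linarith

theorem bound_down_lt {α : ℝ} (hα : 0 < α) (h1 : α < 1) :
    ∃ c > (0:ℝ), ∃ C > (0:ℝ), ∀ N : ℕ, 2 ≤ N →
    c * (N:ℝ)^2 ≤ ∑ k ∈ range N, bdE α N k ∧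
    ∑ k ∈ range N, bdE α N k ≤ C * (N:ℝ)^2 := by
  have hb : 0 < 1 - α := by linarith
  refine ⟨1, one_pos, 2^(α+2) / (1-α), by positivity, fun N hN => ⟨?_, ?_⟩⟩
  · have hE : ∀ k ∈ range N, 2 * ((N:ℝ) - k) ≤ bdE α N k := by
      intro k hk
      have hk : k < N := Finset.mem_range.1 hk
      have h2 := bdW_pos α k
      have h3 : ((N:ℝ) - k) * bdW α k ≤ ∑ j ∈ Ico (k+1) (N+1), bdW α j := by
        calc _ = ∑ j ∈ Ico (k+1) (N+1), bdW α k := by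
              simp [Nat.cast_sub hk.le]
          _ ≤ _ := Finset.sum_le_sum fun j hj =>
              bdW_mono hα (by have := (Finset.mem_Ico.1 hj).1; omega)
      unfold bdE
      rw [div_mul_eq_mul_div, le_div_iff₀ h2]
      linarith
    refine le_trans ?_ (Finset.sum_le_sum hE)
    have : ∀ n : ℕ, ∑ k ∈ range n, 2 * ((N:ℝ) - k) = 2 * N * n - n * (n-1) := by
      intro n
      induction n with
      | zero => simp
      | succ n ih => rw [Finset.sum_range_succ, ih]; push_cast; ring
    rw [this]
    have : (0:ℝ) ≤ N := by positivity
    nlinarith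
  · refine (sum_bdE_le hα N (by omega)).trans ?_
    have hN' : (0:ℝ) < N := by have : 0 < N := by omega
                               exact_mod_cast this
    have h2 := sum_rpow_inv_le hα h1 N
    have h3 : ∑ k ∈ range N, ((1+(k:ℝ))^α)⁻¹ ≤ (N:ℝ)^(1-α) / (1-α) := by
      rw [le_div_iff₀ hb]; linarith
    calc _ ≤ 2 ^ (α+2) * (N:ℝ)^(α+1) * ((N:ℝ)^(1-α) / (1-α)) := by gcongr
      _ = 2 ^ (α+2) / (1-α) * ((N:ℝ)^(α+1) * (N:ℝ)^(1-α)) := by ring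
      _ = _ := by
        rw [← Real.rpow_add hN', show α + 1 + (1-α) = ((2:ℕ):ℝ) by push_cast; ring,
          Real.rpow_natCast]

theorem bdE_one (N k : ℕ) (hk : k < N) :
    bdE 1 N k = ((N:ℝ)+1)*(N+2) * (1+(k:ℝ))⁻¹ - (k+2) := by
  have h : ∀ n : ℕ, ∑ j ∈ range n, bdW 1 j = n*(n+1)/2 := by
    intro n
    induction n with
    | zero => simp
    | succ n ih => rw [Finset.sum_range_succ, ih]; simp only [bdW, Real.rpow_one]; push_cast; ring
  have hp : (0:ℝ) < 1 + k := by positivity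
  unfold bdE
  rw [Finset.sum_Ico_eq_sub _ (by omega), h, h]
  simp only [bdW, Real.rpow_one]
  push_cast
  field_simp
  ring

theorem bound_down_one :
    ∃ c > (0:ℝ), ∃ C > (0:ℝ), ∀ N : ℕ, 2 ≤ N →
    c * ((N:ℝ)^2 * Real.log N) ≤ ∑ k ∈ range N, bdE 1 N k ∧
    ∑ k ∈ range N, bdE 1 N k ≤ C * ((N:ℝ)^2 * Real.log N) := by
  have hl2 : 0 < Real.log 2 := Real.log_pos (by norm_num)
  refine ⟨1/2, by norm_num, 8 * (1 / Real.log 2 + 1), by positivity, fun N hN => ?_⟩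
  have hN' : (2:ℝ) ≤ N := by exact_mod_cast hN
  have hlN : Real.log 2 ≤ Real.log N := Real.log_le_log (by norm_num) hN'
  have hharm : ((harmonic N : ℚ) : ℝ) = ∑ k ∈ range N, (1+(k:ℝ))⁻¹ := by
    unfold harmonic; push_cast
    exact Finset.sum_congr rfl fun k _ => by rw [add_comm]
  have hup := harmonic_le_one_add_log N
  have hlo := log_add_one_le_harmonic N
  rw [hharm] at hup hlo
  constructor
  · have h1 : ∑ k ∈ range N, bdE 1 N k
        = ((N:ℝ)+1)*(N+2) * ∑ k ∈ range N, (1+(k:ℝ))⁻¹ - N*(N+3)/2 := by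
      rw [Finset.sum_congr rfl fun k hk => bdE_one N k (Finset.mem_range.1 hk),
        Finset.sum_sub_distrib, ← Finset.mul_sum]
      congr 1
      have : ∀ n : ℕ, ∑ k ∈ range n, ((k:ℝ)+2) = n*(n+3)/2 := by
        intro n
        induction n with
        | zero => simp
        | succ n ih => rw [Finset.sum_range_succ, ih]; push_cast; ring
      exact this N
    have h2 : 1 ≤ ∑ k ∈ range N, (1+(k:ℝ))⁻¹ := by
      have := Finset.single_le_sum (s := range N) (f := fun k : ℕ => (1+(k:ℝ))⁻¹)
        (fun k _ => by positivity) (Finset.mem_range.2 (show 0 < N by omega))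
      simpa using this
    have h3 : Real.log N ≤ ∑ k ∈ range N, (1+(k:ℝ))⁻¹ := by
      refine le_trans ?_ hlo
      apply Real.log_le_log (by linarith)
      push_cast; linarith
    rw [h1]
    generalize ∑ k ∈ range N, (1+(k:ℝ))⁻¹ = H at *
    have h4 : (N:ℝ)^2 * Real.log N ≤ (N:ℝ)^2 * H := by gcongr
    have h5 : 0 ≤ (3*(N:ℝ)+2) * (H-1) := mul_nonneg (by linarith) (by linarith)
    have h6 : 0 ≤ (N:ℝ)^2 * (H-1) := mul_nonneg (by positivity) (by linarith)
    nlinarith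
  · refine (sum_bdE_le one_pos N (by omega)).trans ?_
    have e : (2:ℝ)^((1:ℝ)+2) = 8 := by
      rw [show (1:ℝ)+2 = ((3:ℕ):ℝ) by norm_num, Real.rpow_natCast]; norm_num
    have e' : (N:ℝ)^((1:ℝ)+1) = (N:ℝ)^2 := by
      rw [show (1:ℝ)+1 = ((2:ℕ):ℝ) by norm_num, Real.rpow_natCast]
    rw [e, e']
    simp only [Real.rpow_one]
    have h3 : ∑ k ∈ range N, (1+(k:ℝ))⁻¹ ≤ (1 / Real.log 2 + 1) * Real.log N := by
      have : 1 ≤ 1 / Real.log 2 * Real.log N := by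
        rw [div_mul_eq_mul_div, le_div_iff₀ hl2]; linarith
      linarith
    calc _ ≤ 8 * (N:ℝ)^2 * ((1 / Real.log 2 + 1) * Real.log N) := by gcongr
      _ = _ := by ring

theorem bound_down (α : ℝ) (hα : 0 < α) :
    ∃ c > (0 : ℝ), ∃ C > (0 : ℝ), ∀ N : ℕ, 2 ≤ N →
      c * (if 1 < α then (N : ℝ) ^ (α + 1)
        else if α = 1 then (N : ℝ) ^ 2 * Real.log N
        else (N : ℝ) ^ 2) ≤ ∑ k ∈ range N, bdE α N k ∧
      ∑ k ∈ range N, bdE α N k ≤ C * (if 1 < α then (N : ℝ) ^ (α + 1)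
        else if α = 1 then (N : ℝ) ^ 2 * Real.log N
        else (N : ℝ) ^ 2) := by
  by_cases h : 1 < α
  · simpa only [h, if_true] using bound_down_gt h
  · by_cases h' : α = 1
    · subst h'
      simpa only [lt_irrefl, if_true, if_false] using bound_down_one
    · simpa only [h, h', if_false] using
        bound_down_lt hα (lt_of_le_of_ne (not_lt.1 h) h')

/-- For the Metropolis birth-death chain on `{0,…,N}` with weights
`(1+k)^α`: `H(0,N) ≍ N²`, while `H(N,0) ≍ N^{α+1}` if `α > 1`, `≍ N² log N` if `α = 1`,
and `≍ N²` if `0 < α < 1`, with constants depending only on `α`. -/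
theorem stmt19 (α : ℝ) (hα : 0 < α) :
    ∃ c > (0 : ℝ), ∃ C > (0 : ℝ), ∀ N : ℕ, 2 ≤ N →
      let M : ℝ :=
        if 1 < α then (N : ℝ) ^ (α + 1)
        else if α = 1 then (N : ℝ) ^ 2 * Real.log N
        else (N : ℝ) ^ 2
      (c * (N : ℝ) ^ 2 ≤ hit (bdK N α) (0 : Fin (N + 1)) (Fin.last N) ∧
        hit (bdK N α) (0 : Fin (N + 1)) (Fin.last N) ≤ C * (N : ℝ) ^ 2) ∧
      (c * M ≤ hit (bdK N α) (Fin.last N) (0 : Fin (N + 1)) ∧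
        hit (bdK N α) (Fin.last N) (0 : Fin (N + 1)) ≤ C * M) := by
  obtain ⟨c, hc, C, hC, hb⟩ := bound_down α hα
  refine ⟨min c (1/(α+1)), lt_min hc (by positivity), max C 2, lt_max_of_lt_left hC,
    fun N hN => ?_⟩
  intro M
  have hM : 0 ≤ M := by
    have : (1:ℝ) ≤ N := by exact_mod_cast (by omega : 1 ≤ N)
    have := Real.log_nonneg this
    simp only [M]
    split_ifs <;> positivity
  have h1 := bound_up hα N
  have h2 : c * M ≤ ∑ k ∈ range N, bdE α N k ∧ ∑ k ∈ range N, bdE α N k ≤ C * M := hb N hN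
  rw [hit_up hα, hit_down hα]
  exact ⟨⟨(mul_le_mul_of_nonneg_right (min_le_right _ _) (by positivity)).trans h1.1,
    h1.2.trans (mul_le_mul_of_nonneg_right (le_max_right _ _) (by positivity))⟩,
    (mul_le_mul_of_nonneg_right (min_le_left _ _) hM).trans h2.1,
    h2.2.trans (mul_le_mul_of_nonneg_right (le_max_left _ _) hM)⟩
end
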